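/- arXiv:1202.4427 — 5 statements merged into one kernel-verified Lean document; each statement's English description precedes it below -/
import Mathlib

section
/- The base-2 logarithm of the number of maximal antichains of the Boolean lattice B_n is asymptotically binomial(n-1, ⌊n/2⌋); precisely, (log₂ ma(B_n)) / binomial(n-1, ⌊n/2⌋) tends to 1 as n → ∞. -/
/-- The number of maximal antichains of the Boolean lattice `B_n` of subsets of `{1, …, n}`
ordered by inclusion. -/
noncomputable def ma (n : ℕ) : ℕ :=
  {A : Set (Finset (Fin n)) | Maximal (fun s => IsAntichain (· ⊆ ·) s) A}.ncard

section MaximalAntichains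

open Finset

namespace SimpleGraph

section MaximalIndependent

variable {V : Type*} (G : SimpleGraph V) [DecidableRel G.Adj]

/-- The neighbours of `v` inside the finite vertex set `S`. -/
def neighborsIn (S : Finset V) (v : V) : Finset V := {x ∈ S | G.Adj v x}

variable {G} {S I : Finset V} {u v w x : V}

lemma mem_neighborsIn : x ∈ G.neighborsIn S v ↔ x ∈ S ∧ G.Adj v x := by simp [neighborsIn]

lemma notMem_neighborsIn_self : v ∉ G.neighborsIn S v := by simp [mem_neighborsIn]

variable [DecidableEq V]

variable (G) in
/-- The vertices of `S` outside the closed neighbourhood of `v`. -/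
def avoiding (S : Finset V) (v : V) : Finset V := {x ∈ S | x ≠ v ∧ ¬ G.Adj v x}

variable (G) in
/-- The maximal independent sets of the subgraph of `G` induced on the finite vertex set `S`. -/
def maximalIndepSets (S : Finset V) : Finset (Finset V) :=
  {I ∈ S.powerset | (∀ a ∈ I, ∀ b ∈ I, ¬ G.Adj a b) ∧ ∀ v ∈ S, v ∉ I → ∃ u ∈ I, G.Adj u v}

lemma mem_avoiding : x ∈ G.avoiding S v ↔ x ∈ S ∧ x ≠ v ∧ ¬ G.Adj v x := by simp [avoiding]

lemma mem_maximalIndepSets : I ∈ G.maximalIndepSets S ↔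
    I ⊆ S ∧ (∀ a ∈ I, ∀ b ∈ I, ¬ G.Adj a b) ∧ ∀ v ∈ S, v ∉ I → ∃ u ∈ I, G.Adj u v := by
  simp [maximalIndepSets]

lemma avoiding_subset : G.avoiding S v ⊆ S := fun _ hx => (mem_avoiding.1 hx).1

lemma card_avoiding (hv : v ∈ S) :
    #(G.avoiding S v) + (#(G.neighborsIn S v) + 1) = #S := by
  rw [← card_insert_of_notMem (notMem_neighborsIn_self (G := G) (S := S) (v := v)),
    ← card_union_of_disjoint]
  · congr 1
    ext x
    simp only [mem_union, mem_insert, mem_avoiding, mem_neighborsIn]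
    by_cases h : x = v <;> by_cases h' : G.Adj v x <;> simp_all
  · rw [Finset.disjoint_left]
    intro x hx
    simp only [mem_insert, mem_avoiding, mem_neighborsIn] at hx ⊢
    tauto

lemma maximalIndepSets_mono_mem {C : Finset V} (hI : I ∈ G.maximalIndepSets S) (hIC : I ⊆ C)
    (hC : C ⊆ S) : I ∈ G.maximalIndepSets C := by
  rw [mem_maximalIndepSets] at hI ⊢
  exact ⟨hIC, hI.2.1, fun v hv => hI.2.2 v (hC hv)⟩

lemma erase_mem_maximalIndepSets (hI : I ∈ G.maximalIndepSets S) (hv : v ∈ I) :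
    I.erase v ∈ G.maximalIndepSets (G.avoiding S v) := by
  rw [mem_maximalIndepSets] at hI ⊢
  obtain ⟨hIS, hind, hmax⟩ := hI
  refine ⟨fun x hx => ?_, fun a ha b hb => hind a (mem_of_mem_erase ha) b (mem_of_mem_erase hb),
    fun x hx hxI => ?_⟩
  · rw [mem_erase] at hx
    exact mem_avoiding.2 ⟨hIS hx.2, hx.1, hind v hv x hx.2⟩
  · rw [mem_avoiding] at hx
    have hxI' : x ∉ I := fun h => hxI (mem_erase.2 ⟨hx.2.1, h⟩)
    obtain ⟨y, hy, hyx⟩ := hmax x hx.1 hxI'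
    refine ⟨y, mem_erase.2 ⟨?_, hy⟩, hyx⟩
    rintro rfl
    exact hx.2.2 hyx

lemma card_filter_mem_maximalIndepSets_le :
    #{I ∈ G.maximalIndepSets S | v ∈ I} ≤ #(G.maximalIndepSets (G.avoiding S v)) := by
  refine card_le_card_of_injOn (fun I => I.erase v) (fun I hI => ?_) (fun I hI J hJ h => ?_)
  · rw [mem_coe, mem_filter] at hI
    exact erase_mem_maximalIndepSets hI.1 hI.2
  · rw [mem_coe, mem_filter] at hI hJ
    rw [← insert_erase hI.2, ← insert_erase hJ.2]
    exact congrArg (insert v) h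

lemma card_filter_mem_notMem_maximalIndepSets_le :
    #{I ∈ G.maximalIndepSets S | w ∈ I ∧ u ∉ I} ≤
      #(G.maximalIndepSets ((G.avoiding S w).erase u)) := by
  refine card_le_card_of_injOn (fun I => I.erase w) (fun I hI => ?_) (fun I hI J hJ h => ?_)
  · rw [mem_coe, mem_filter] at hI
    have h := erase_mem_maximalIndepSets hI.1 hI.2.1
    refine maximalIndepSets_mono_mem h (fun x hx => mem_erase.2 ⟨?_, ?_⟩) (erase_subset _ _)
    · rintro rfl
      exact hI.2.2 (mem_of_mem_erase hx)
    · exact (mem_maximalIndepSets.1 h).1 hx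
  · rw [mem_coe, mem_filter] at hI hJ
    rw [← insert_erase hI.2.1, ← insert_erase hJ.2.1]
    exact congrArg (insert w) h

/-- Some vertex of each closed neighbourhood lies in a given maximal independent set. -/
lemma card_maximalIndepSets_le_sum (hv : v ∈ S) :
    #(G.maximalIndepSets S) ≤
      ∑ u ∈ insert v (G.neighborsIn S v), #(G.maximalIndepSets (G.avoiding S u)) := by
  refine le_trans ?_ (sum_le_sum fun u _ => card_filter_mem_maximalIndepSets_le)
  refine le_trans (card_le_card ?_) card_biUnion_le
  intro I hI
  obtain ⟨hIS, hind, hmax⟩ := mem_maximalIndepSets.1 hI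
  rw [mem_biUnion]
  by_cases h : v ∈ I
  · exact ⟨v, mem_insert_self _ _, mem_filter.2 ⟨hI, h⟩⟩
  · obtain ⟨u, hu, huv⟩ := hmax v hv h
    exact ⟨u, mem_insert_of_mem (mem_neighborsIn.2 ⟨hIS hu, huv.symm⟩), mem_filter.2 ⟨hI, hu⟩⟩

lemma card_maximalIndepSets_le_of_neighborsIn_eq_pair (hv : v ∈ S)
    (hN : G.neighborsIn S v = {u, w}) :
    #(G.maximalIndepSets S) ≤ #(G.maximalIndepSets (G.avoiding S v)) +
      #(G.maximalIndepSets (G.avoiding S u)) +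
      #(G.maximalIndepSets ((G.avoiding S w).erase u)) := by
  refine le_trans ?_ (Nat.add_le_add (Nat.add_le_add
    (card_filter_mem_maximalIndepSets_le (v := v)) (card_filter_mem_maximalIndepSets_le (v := u)))
    (card_filter_mem_notMem_maximalIndepSets_le (u := u) (w := w)))
  refine le_trans (card_le_card ?_) ((card_union_le _ _).trans
    (Nat.add_le_add_right (card_union_le _ _) _))
  intro I hI
  obtain ⟨hIS, hind, hmax⟩ := mem_maximalIndepSets.1 hI
  simp only [mem_union, mem_filter, hI, true_and]
  by_cases h : v ∈ I
  · exact Or.inl (Or.inl h)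
  · obtain ⟨y, hy, hyv⟩ := hmax v hv h
    have : y ∈ G.neighborsIn S v := mem_neighborsIn.2 ⟨hIS hy, hyv.symm⟩
    rw [hN, mem_insert, mem_singleton] at this
    by_cases hu : u ∈ I
    · exact Or.inl (Or.inr hu)
    · rcases this with rfl | rfl
      · exact absurd hy hu
      · exact Or.inr ⟨hy, hu⟩

lemma exists_maximalIndepSets_superset (hIS : I ⊆ S) (hind : ∀ a ∈ I, ∀ b ∈ I, ¬ G.Adj a b) :
    ∃ J ∈ G.maximalIndepSets S, I ⊆ J := by
  obtain ⟨J, hIJ, hJ⟩ := Finite.exists_le_maximal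
    (p := fun J : {J : Finset V // J ∈ S.powerset} => ∀ a ∈ J.1, ∀ b ∈ J.1, ¬ G.Adj a b)
    (a := ⟨I, mem_powerset.2 hIS⟩) hind
  have hJS := mem_powerset.1 J.2
  refine ⟨J.1, mem_maximalIndepSets.2 ⟨hJS, hJ.1, fun v hv hvJ => ?_⟩, hIJ⟩
  by_contra! hcon
  have hle := hJ.2 (y := ⟨insert v J.1, mem_powerset.2 (insert_subset hv hJS)⟩) (by
    intro a ha b hb
    rw [mem_insert] at ha hb
    rcases ha with rfl | ha <;> rcases hb with rfl | hb
    · exact G.loopless.irrefl _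
    · exact fun h => hcon b hb h.symm
    · exact hcon a ha
    · exact hJ.1 a ha b hb) (subset_insert _ _)
  exact hvJ (hle (mem_insert_self _ _))

/-- The graph container lemma: few sets inducing small maximum degree cover all independent
sets. -/
lemma exists_containers {d : ℕ} {y : ℝ} (hy : 1 ≤ y) (hd : y ^ d + 1 ≤ y ^ (d + 1))
    (S : Finset V) :
    ∃ 𝒞 : Finset (Finset V), (∀ C ∈ 𝒞, C ⊆ S ∧ ∀ v ∈ C, #(G.neighborsIn C v) ≤ d) ∧
      (∀ I ⊆ S, (∀ a ∈ I, ∀ b ∈ I, ¬ G.Adj a b) → ∃ C ∈ 𝒞, I ⊆ C) ∧ (#𝒞 : ℝ) ≤ y ^ #S := by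
  induction S using Finset.strongInduction with
  | H S ih =>
  have hy0 : (0 : ℝ) < y := by linarith
  by_cases hS : ∀ v ∈ S, #(G.neighborsIn S v) ≤ d
  · exact ⟨{S}, by simpa using hS, fun I hI _ => ⟨S, by simp, hI⟩,
      by simpa using one_le_pow₀ hy⟩
  push Not at hS
  obtain ⟨v, hv, hvd⟩ := hS
  have hvA : v ∉ G.avoiding S v := by simp [mem_avoiding]
  obtain ⟨𝒞₁, h₁, hc₁, hn₁⟩ := ih (S.erase v) (erase_ssubset hv)
  obtain ⟨𝒞₂, h₂, hc₂, hn₂⟩ := ih (G.avoiding S v)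
    ((ssubset_iff_of_subset avoiding_subset).2 ⟨v, hv, hvA⟩)
  refine ⟨𝒞₁ ∪ 𝒞₂.image (insert v), fun C hC => ?_, fun I hI hind => ?_, ?_⟩
  · rw [mem_union, mem_image] at hC
    rcases hC with hC | ⟨C, hC, rfl⟩
    · exact ⟨(h₁ C hC).1.trans (erase_subset _ _), (h₁ C hC).2⟩
    · refine ⟨insert_subset hv ((h₂ C hC).1.trans avoiding_subset), fun x hx => ?_⟩
      have hna : ∀ z ∈ C, ¬ G.Adj v z := fun z hz => (mem_avoiding.1 ((h₂ C hC).1 hz)).2.2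
      rw [mem_insert] at hx
      rcases hx with rfl | hx
      · have : G.neighborsIn (insert x C) x = ∅ := by
          refine eq_empty_of_forall_notMem fun z hz => ?_
          rw [mem_neighborsIn, mem_insert] at hz
          rcases hz with ⟨rfl | hz, hadj⟩
          · exact G.loopless.irrefl _ hadj
          · exact hna z hz hadj
        simp [this]
      · refine le_trans (card_le_card fun z hz => ?_) ((h₂ C hC).2 x hx)
        rw [mem_neighborsIn, mem_insert] at hz
        rcases hz with ⟨rfl | hz, hadj⟩
        · exact absurd hadj.symm (hna x hx)
        · exact mem_neighborsIn.2 ⟨hz, hadj⟩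
  · by_cases hvI : v ∈ I
    · obtain ⟨C, hC, hIC⟩ := hc₂ (I.erase v) (fun x hx => by
        rw [mem_erase] at hx
        exact mem_avoiding.2 ⟨hI hx.2, hx.1, hind v hvI x hx.2⟩)
        (fun a ha b hb => hind a (mem_of_mem_erase ha) b (mem_of_mem_erase hb))
      refine ⟨insert v C, mem_union_right _ (mem_image_of_mem _ hC), ?_⟩
      rw [← insert_erase hvI]
      exact insert_subset_insert _ hIC
    · obtain ⟨C, hC, hIC⟩ := hc₁ I (fun x hx => mem_erase.2 ⟨by rintro rfl; exact hvI hx, hI hx⟩)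
        hind
      exact ⟨C, mem_union_left _ hC, hIC⟩
  · have hcard := card_avoiding (G := G) hv
    have hle : (#(𝒞₁ ∪ 𝒞₂.image (insert v)) : ℝ) ≤ #𝒞₁ + #𝒞₂ := by
      exact_mod_cast (card_union_le _ _).trans (Nat.add_le_add_left card_image_le _)
    have he : #(S.erase v) = (#S - (d + 1)) + d := by rw [card_erase_of_mem hv]; omega
    have ha : y ^ #(G.avoiding S v) ≤ y ^ (#S - (d + 1)) := pow_le_pow_right₀ hy (by omega)
    have hs : #S = (#S - (d + 1)) + (d + 1) := by omega
    rw [he, pow_add] at hn₁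
    have hpos : 0 < y ^ (#S - (d + 1)) := pow_pos hy0 _
    rw [hs, pow_add]
    nlinarith [mul_le_mul_of_nonneg_left hd hpos.le]

end MaximalIndependent

section Comparability

variable {α : Type*}

variable (α) in
/-- The comparability graph of the lattice of finite subsets of `α`. -/
def comparability : SimpleGraph (Finset α) where
  Adj A B := A ⊂ B ∨ B ⊂ A
  symm := ⟨fun _ _ h => h.symm⟩
  loopless := ⟨fun A h => (h.elim (ssubset_irrefl A) (ssubset_irrefl A))⟩

lemma comparability_adj {A B : Finset α} : (comparability α).Adj A B ↔ A ⊂ B ∨ B ⊂ A := Iff.rfl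

variable [DecidableEq α]

instance : DecidableRel (comparability α).Adj :=
  fun A B => inferInstanceAs (Decidable (A ⊂ B ∨ B ⊂ A))

/-- The family `S` together with the relative complement of `B` in the interval from `A` to `C`,
for every three-element chain `A ⊂ B ⊂ C` of members of `S`. -/
def diamondHull (S : Finset (Finset α)) : Finset (Finset α) :=
  S ∪ ({t ∈ S ×ˢ S ×ˢ S | t.1 ⊂ t.2.1 ∧ t.2.1 ⊂ t.2.2}).image fun t => t.1 ∪ t.2.2 \ t.2.1

variable {S T : Finset (Finset α)} {A B C E u v w : Finset α}

lemma mem_diamondHull : E ∈ diamondHull S ↔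
    E ∈ S ∨ ∃ A ∈ S, ∃ B ∈ S, ∃ C ∈ S, A ⊂ B ∧ B ⊂ C ∧ A ∪ C \ B = E := by
  simp only [diamondHull, mem_union, mem_image, mem_filter, mem_product, Prod.exists]
  refine or_congr Iff.rfl ⟨?_, ?_⟩
  · rintro ⟨A, B, C, ⟨⟨hA, hB, hC⟩, h₁, h₂⟩, h⟩
    exact ⟨A, hA, B, hB, C, hC, h₁, h₂, h⟩
  · rintro ⟨A, hA, B, hB, C, hC, h₁, h₂, h⟩
    exact ⟨A, B, C, ⟨⟨hA, hB, hC⟩, h₁, h₂⟩, h⟩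

lemma subset_diamondHull : S ⊆ diamondHull S := subset_union_left

lemma diamondHull_mono (h : S ⊆ T) : diamondHull S ⊆ diamondHull T := by
  intro E hE
  rw [mem_diamondHull] at hE ⊢
  rcases hE with hE | ⟨A, hA, B, hB, C, hC, h'⟩
  · exact Or.inl (h hE)
  · exact Or.inr ⟨A, h hA, B, h hB, C, h hC, h'⟩

lemma ssubset_union_sdiff (hAB : A ⊂ B) (hBC : B ⊂ C) : A ⊂ A ∪ C \ B := by
  obtain ⟨x, hxC, hxB⟩ := exists_of_ssubset hBC
  refine (ssubset_iff_of_subset subset_union_left).2 ⟨x, ?_, fun h => hxB (hAB.1 h)⟩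
  simp [hxC, hxB]

lemma union_sdiff_ssubset (hAB : A ⊂ B) (hBC : B ⊂ C) : A ∪ C \ B ⊂ C := by
  obtain ⟨x, hxB, hxA⟩ := exists_of_ssubset hAB
  refine (ssubset_iff_of_subset (union_subset (hAB.1.trans hBC.1) sdiff_subset)).2
    ⟨x, hBC.1 hxB, ?_⟩
  simp [hxA, hxB]

lemma union_sdiff_ne (hBC : B ⊂ C) : A ∪ C \ B ≠ B := by
  obtain ⟨x, hxC, hxB⟩ := exists_of_ssubset hBC
  intro h
  apply hxB
  rw [← h]
  simp [hxC, hxB]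

lemma eq_or_between_of_mem_diamondHull (h : E ∈ diamondHull S) :
    E ∈ S ∨ ∃ A ∈ S, ∃ C ∈ S, A ⊂ E ∧ E ⊂ C := by
  rw [mem_diamondHull] at h
  rcases h with h | ⟨A, hA, B, hB, C, hC, h₁, h₂, rfl⟩
  · exact Or.inl h
  · exact Or.inr ⟨A, hA, C, hC, ssubset_union_sdiff h₁ h₂, union_sdiff_ssubset h₁ h₂⟩

lemma ne_and_not_adj_of_mem_diamondHull_avoiding
    (h : E ∈ diamondHull ((comparability α).avoiding S u)) :
    E ≠ u ∧ ¬ (comparability α).Adj u E := by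
  rcases eq_or_between_of_mem_diamondHull h with h | ⟨A, hA, C, hC, hAE, hEC⟩
  · exact (mem_avoiding.1 h).2
  · have hA := (mem_avoiding.1 hA).2.2
    have hC := (mem_avoiding.1 hC).2.2
    rw [comparability_adj] at hA hC ⊢
    refine ⟨?_, ?_⟩
    · rintro rfl
      exact hA (Or.inr hAE)
    · rintro (h | h)
      · exact hC (Or.inl (h.trans hEC))
      · exact hA (Or.inr (hAE.trans h))

lemma card_diamondHull_add_card_le {U : Finset (Finset α)} (hTS : T ⊆ S)
    (hU : U ⊆ diamondHull S) (hTU : ∀ E ∈ U, E ∉ diamondHull T) :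
    #(diamondHull T) + #U ≤ #(diamondHull S) := by
  rw [← card_union_of_disjoint (Finset.disjoint_right.2 hTU)]
  exact card_le_card (union_subset (diamondHull_mono hTS) hU)

lemma notMem_diamondHull_avoiding (h : E = u ∨ (comparability α).Adj u E) :
    E ∉ diamondHull ((comparability α).avoiding S u) := fun hE => by
  have := ne_and_not_adj_of_mem_diamondHull_avoiding hE
  tauto

lemma card_diamondHull_avoiding (hu : u ∈ S) :
    #(diamondHull ((comparability α).avoiding S u)) +
      (#((comparability α).neighborsIn S u) + 1) ≤ #(diamondHull S) := by
  rw [← card_insert_of_notMem notMem_neighborsIn_self]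
  refine card_diamondHull_add_card_le avoiding_subset ?_ fun E hE => ?_
  · refine insert_subset (subset_diamondHull hu) fun x hx => ?_
    exact subset_diamondHull (mem_neighborsIn.1 hx).1
  · rw [mem_insert, mem_neighborsIn] at hE
    exact notMem_diamondHull_avoiding (hE.imp_right And.right)

lemma card_diamondHull_avoiding_of_triangle (hA : A ∈ S) (hB : B ∈ S) (hC : C ∈ S)
    (hAB : A ⊂ B) (hBC : B ⊂ C) (hNA : (comparability α).neighborsIn S A = {B, C})
    (hNB : (comparability α).neighborsIn S B = {A, C})
    (hNC : (comparability α).neighborsIn S C = {A, B}) :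
    ∀ u ∈ ({A, B, C} : Finset (Finset α)),
      #(diamondHull ((comparability α).avoiding S u)) + 4 ≤ #(diamondHull S) := by
  have hAC := hAB.trans hBC
  set E := A ∪ C \ B with hE
  have hAE : A ⊂ E := ssubset_union_sdiff hAB hBC
  have hEC : E ⊂ C := union_sdiff_ssubset hAB hBC
  have hES : E ∈ diamondHull S :=
    mem_diamondHull.2 (Or.inr ⟨A, hA, B, hB, C, hC, hAB, hBC, rfl⟩)
  have hcard : #({A, B, C, E} : Finset (Finset α)) = 4 := by
    rw [card_insert_of_notMem, card_insert_of_notMem, card_insert_of_notMem, card_singleton]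
    · simpa using hEC.ne'
    · simpa using ⟨hBC.ne, (union_sdiff_ne hBC).symm⟩
    · simpa using ⟨hAB.ne, hAC.ne, hAE.ne⟩
  have key : #(diamondHull ((comparability α).avoiding S A)) + 4 ≤ #(diamondHull S) := by
    rw [← hcard]
    refine card_diamondHull_add_card_le avoiding_subset ?_ fun x hx => ?_
    · simp [insert_subset_iff, hES, subset_diamondHull hA, subset_diamondHull hB,
        subset_diamondHull hC]
    · simp only [mem_insert, mem_singleton] at hx
      apply notMem_diamondHull_avoiding
      rw [comparability_adj]
      rcases hx with rfl | rfl | rfl | rfl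
      · exact Or.inl rfl
      · exact Or.inr (Or.inl hAB)
      · exact Or.inr (Or.inl hAC)
      · exact Or.inr (Or.inl hAE)
  have hav : ∀ x, x ∈ (comparability α).avoiding S A ↔ x ∈ S ∧ x ≠ A ∧ x ≠ B ∧ x ≠ C := by
    intro x
    have := congrArg (x ∈ ·) hNA
    simp only [mem_neighborsIn, mem_insert, mem_singleton, eq_iff_iff] at this
    rw [mem_avoiding]
    tauto
  have hBeq : (comparability α).avoiding S B = (comparability α).avoiding S A := by
    ext x
    have := congrArg (x ∈ ·) hNB
    simp only [mem_neighborsIn, mem_insert, mem_singleton, eq_iff_iff] at this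
    rw [hav, mem_avoiding]
    tauto
  have hCeq : (comparability α).avoiding S C = (comparability α).avoiding S A := by
    ext x
    have := congrArg (x ∈ ·) hNC
    simp only [mem_neighborsIn, mem_insert, mem_singleton, eq_iff_iff] at this
    rw [hav, mem_avoiding]
    tauto
  simp [hBeq, hCeq, key]

lemma card_diamondHull_avoiding_erase (hw : w ∈ S) (hu : u ∈ S) (hvw : (comparability α).Adj v w)
    (hvu : (comparability α).Adj v u) (hv : v ∈ S) (huw : u ≠ w)
    (hnuw : ¬ (comparability α).Adj u w)
    (hdu : #((comparability α).neighborsIn S u) = 2) :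
    #(diamondHull (((comparability α).avoiding S w).erase u)) +
      (#((comparability α).neighborsIn S w) + 2) ≤ #(diamondHull S) := by
  have hcard : #(insert u (insert w ((comparability α).neighborsIn S w))) =
      #((comparability α).neighborsIn S w) + 2 := by
    rw [card_insert_of_notMem, card_insert_of_notMem notMem_neighborsIn_self]
    rw [mem_insert, mem_neighborsIn]
    rintro (h | h)
    · exact huw h
    · exact hnuw h.2.symm
  rw [← hcard]
  refine card_diamondHull_add_card_le ((erase_subset _ _).trans avoiding_subset) ?_
    fun E hE => ?_
  · refine insert_subset (subset_diamondHull hu) (insert_subset (subset_diamondHull hw) ?_)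
    exact fun x hx => subset_diamondHull (mem_neighborsIn.1 hx).1
  rw [mem_insert, mem_insert, mem_neighborsIn] at hE
  rcases hE with rfl | hE
  · intro hE
    rcases eq_or_between_of_mem_diamondHull hE with h | ⟨A, hA, C, hC, hAE, hEC⟩
    · exact notMem_erase _ _ h
    have hvA : v ≠ A := by
      rintro rfl
      exact (mem_avoiding.1 (mem_of_mem_erase hA)).2.2 hvw.symm
    have hvC : v ≠ C := by
      rintro rfl
      exact (mem_avoiding.1 (mem_of_mem_erase hC)).2.2 hvw.symm
    have hsub : {v, A, C} ⊆ (comparability α).neighborsIn S E := by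
      intro x hx
      simp only [mem_insert, mem_singleton] at hx
      rw [mem_neighborsIn]
      rcases hx with rfl | rfl | rfl
      · exact ⟨hv, hvu.symm⟩
      · exact ⟨avoiding_subset (mem_of_mem_erase hA), Or.inr hAE⟩
      · exact ⟨avoiding_subset (mem_of_mem_erase hC), Or.inl hEC⟩
    have := card_le_card hsub
    rw [hdu, card_insert_of_notMem (by simp [hvA, hvC]), card_pair (hAE.trans hEC).ne] at this
    omega
  · exact fun h => notMem_diamondHull_avoiding (hE.imp_right And.right)
      (diamondHull_mono (erase_subset _ _) h)

lemma succ_le_sqrt_two_pow {d : ℕ} (hd : d ≠ 2) : ((d : ℝ) + 1) ≤ √2 ^ (d + 1) := by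
  have hnat : (d + 1) ^ 2 ≤ 2 ^ (d + 1) := by
    rcases Nat.lt_or_ge d 3 with h | h
    · interval_cases d <;> simp_all
    · induction d, h using Nat.le_induction with
      | base => norm_num
      | succ k hk ih =>
        have := ih (by omega)
        rw [pow_succ 2 (k + 1)]
        nlinarith
  have hs : (√2 ^ (d + 1)) ^ 2 = 2 ^ (d + 1) := by
    rw [← pow_mul, mul_comm, pow_mul, Real.sq_sqrt (by norm_num)]
  refine le_of_sq_le_sq ?_ (by positivity)
  rw [hs]
  exact_mod_cast hnat

/-- A family of finite sets has at most `2 ^ (m / 2)` maximal antichains, where `m` is the size of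
its diamond hull. -/
theorem card_maximalIndepSets_le_sqrt_two_pow (S : Finset (Finset α)) :
    (#((comparability α).maximalIndepSets S) : ℝ) ≤ √2 ^ #(diamondHull S) := by
  induction S using Finset.strongInduction with
  | H S ih =>
  set G := comparability α
  rcases S.eq_empty_or_nonempty with rfl | hne
  · have : #(G.maximalIndepSets ∅) ≤ 1 := by
      refine (card_le_card (filter_subset _ _)).trans (by simp)
    exact le_trans (by exact_mod_cast this) (one_le_pow₀ (Real.one_le_sqrt.2 (by norm_num)))
  have hr0 : 0 < √2 := by positivity
  have hr1 : 1 ≤ √2 := Real.one_le_sqrt.2 (by norm_num)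
  have hr2 : √2 * √2 = 2 := Real.mul_self_sqrt (by norm_num)
  have hr3 : √2 ≤ 3 / 2 := by nlinarith
  set t := √2 ^ #(diamondHull S) with ht
  have ht0 : 0 < t := by positivity
  have bound : ∀ T ⊂ S, ∀ k, #(diamondHull T) + k ≤ #(diamondHull S) →
      (#(G.maximalIndepSets T) : ℝ) * √2 ^ k ≤ t := fun T hT k hk => by
    refine (mul_le_mul_of_nonneg_right (ih T hT) (by positivity)).trans ?_
    rw [← pow_add]
    exact pow_le_pow_right₀ hr1 hk
  have hav : ∀ u ∈ S, G.avoiding S u ⊂ S := fun u hu =>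
    (ssubset_iff_of_subset avoiding_subset).2 ⟨u, hu, by simp [mem_avoiding]⟩
  have hbound : ∀ u ∈ S, ∀ k ≤ #(G.neighborsIn S u) + 1,
      (#(G.maximalIndepSets (G.avoiding S u)) : ℝ) * √2 ^ k ≤ t := fun u hu k hk =>
    bound _ (hav u hu) k ((Nat.add_le_add_left hk _).trans (card_diamondHull_avoiding hu))
  obtain ⟨v, hv, hmin⟩ := exists_min_image S (fun u => #(G.neighborsIn S u)) hne
  have hsum : (#(G.maximalIndepSets S) : ℝ) ≤
      ∑ u ∈ insert v (G.neighborsIn S v), (#(G.maximalIndepSets (G.avoiding S u)) : ℝ) := by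
    exact_mod_cast card_maximalIndepSets_le_sum hv
  have hcl : ∀ u ∈ insert v (G.neighborsIn S v), u ∈ S := fun u hu =>
    (mem_insert.1 hu).elim (fun h => h ▸ hv) fun h => (mem_neighborsIn.1 h).1
  by_cases hd : #(G.neighborsIn S v) = 2
  · obtain ⟨u, w, huw, hN⟩ := card_eq_two.1 hd
    obtain ⟨hu, hvu⟩ := mem_neighborsIn.1 (show u ∈ G.neighborsIn S v by simp [hN])
    obtain ⟨hw, hvw⟩ := mem_neighborsIn.1 (show w ∈ G.neighborsIn S v by simp [hN])
    have hsum3 : (#(G.maximalIndepSets S) : ℝ) ≤ #(G.maximalIndepSets (G.avoiding S v)) +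
        (#(G.maximalIndepSets (G.avoiding S u)) + #(G.maximalIndepSets (G.avoiding S w))) := by
      rw [hN, sum_insert (by simp [hvu.ne, hvw.ne]), sum_pair huw] at hsum
      exact hsum
    have p3 : √2 ^ 3 = 2 * √2 := by rw [pow_succ, sq, hr2]
    have p4 : √2 ^ 4 = 4 := by rw [pow_succ, p3]; linarith
    have fin3 : ∀ x : ℝ, x * √2 ^ 3 ≤ t → x ≤ t * (3 / 8) := fun x hx => by
      rw [p3] at hx
      have h1 : x * (2 * √2) * √2 ≤ t * √2 := mul_le_mul_of_nonneg_right hx hr0.le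
      have h2 : x * (2 * √2) * √2 = x * 4 := by linear_combination (2 * x) * hr2
      nlinarith
    have fin4 : ∀ x : ℝ, x * √2 ^ 4 ≤ t → x ≤ t * (1 / 4) := fun x hx => by
      rw [p4] at hx
      linarith
    have hv3 := fin3 _ (hbound v hv 3 (by omega))
    have hu2 : 2 ≤ #(G.neighborsIn S u) := hd ▸ hmin u hu
    have hw2 : 2 ≤ #(G.neighborsIn S w) := hd ▸ hmin w hw
    have hu3 := fin3 _ (hbound u hu 3 (by omega))
    have hw3 := fin3 _ (hbound w hw 3 (by omega))
    rcases hu2.lt_or_eq with hu2 | hu2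
    · have := fin4 _ (hbound u hu 4 (by omega))
      linarith
    rcases hw2.lt_or_eq with hw2 | hw2
    · have := fin4 _ (hbound w hw 4 (by omega))
      linarith
    by_cases huw' : G.Adj u w
    · have hNu : G.neighborsIn S u = {v, w} := by
        refine (eq_of_subset_of_card_le (fun x hx => ?_) ?_).symm
        · rw [mem_insert, mem_singleton] at hx
          rcases hx with rfl | rfl
          exacts [mem_neighborsIn.2 ⟨hv, hvu.symm⟩, mem_neighborsIn.2 ⟨hw, huw'⟩]
        · rw [← hu2, card_pair hvw.ne]
      have hNw : G.neighborsIn S w = {v, u} := by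
        refine (eq_of_subset_of_card_le (fun x hx => ?_) ?_).symm
        · rw [mem_insert, mem_singleton] at hx
          rcases hx with rfl | rfl
          exacts [mem_neighborsIn.2 ⟨hv, hvw.symm⟩, mem_neighborsIn.2 ⟨hu, huw'.symm⟩]
        · rw [← hw2, card_pair hvu.ne]
      have key : ∀ x ∈ ({v, u, w} : Finset (Finset α)),
          #(diamondHull (G.avoiding S x)) + 4 ≤ #(diamondHull S) := by
        have tri := @card_diamondHull_avoiding_of_triangle α _ S
        rcases hvu with h₁ | h₁ <;> rcases hvw with h₂ | h₂ <;> rcases huw' with h₃ | h₃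
        · exact tri hv hu hw h₁ h₃ hN hNu hNw
        · have := tri hv hw hu h₂ h₃ (hN.trans (pair_comm _ _)) hNw hNu
          intro x hx
          exact this x (by simpa [or_comm] using hx)
        · exact absurd (h₂.trans h₁).1 h₃.not_subset
        · have := tri hw hv hu h₂ h₁ hNw (hN.trans (pair_comm _ _)) (hNu.trans (pair_comm _ _))
          intro x hx
          refine this x ?_
          simp only [mem_insert, mem_singleton] at hx ⊢
          tauto
        · have := tri hu hv hw h₁ h₂ hNu hN (hNw.trans (pair_comm _ _))
          intro x hx
          refine this x ?_
          simp only [mem_insert, mem_singleton] at hx ⊢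
          tauto
        · exact absurd (h₁.trans h₂).1 h₃.not_subset
        · have := tri hu hw hv h₃ h₂ (hNu.trans (pair_comm _ _)) (hNw.trans (pair_comm _ _)) hN
          intro x hx
          refine this x ?_
          simp only [mem_insert, mem_singleton] at hx ⊢
          tauto
        · have := tri hw hu hv h₃ h₁ (hNw.trans (pair_comm _ _)) (hNu.trans (pair_comm _ _))
            (hN.trans (pair_comm _ _))
          intro x hx
          refine this x ?_
          simp only [mem_insert, mem_singleton] at hx ⊢
          tauto
      have hv4 := fin4 _ (bound _ (hav v hv) 4 (key v (by simp)))
      have hu4 := fin4 _ (bound _ (hav u hu) 4 (key u (by simp)))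
      have hw4 := fin4 _ (bound _ (hav w hw) 4 (key w (by simp)))
      linarith
    · have hb := card_maximalIndepSets_le_of_neighborsIn_eq_pair hv hN
      have hlast := fin4 _ (bound _ ((erase_subset u _).trans_ssubset (hav w hw)) 4 (by
        have := card_diamondHull_avoiding_erase hw hu hvw hvu hv huw huw' hu2.symm
        change _ + (#(G.neighborsIn S w) + 2) ≤ _ at this
        rwa [← hw2] at this))
      have hb' : (#(G.maximalIndepSets S) : ℝ) ≤ #(G.maximalIndepSets (G.avoiding S v)) +
          #(G.maximalIndepSets (G.avoiding S u)) +
          #(G.maximalIndepSets ((G.avoiding S w).erase u)) := by exact_mod_cast hb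
      linarith
  · set d := #(G.neighborsIn S v) with hdv
    refine hsum.trans ?_
    have hp : 0 < √2 ^ (d + 1) := by positivity
    calc _ ≤ ∑ u ∈ insert v (G.neighborsIn S v), t / √2 ^ (d + 1) := sum_le_sum fun u hu => by
            rw [le_div_iff₀ hp]
            exact hbound u (hcl u hu) _ (Nat.add_le_add_right (hmin u (hcl u hu)) 1)
      _ = ((d : ℝ) + 1) * (t / √2 ^ (d + 1)) := by
            rw [sum_const, card_insert_of_notMem notMem_neighborsIn_self, ← hdv, nsmul_eq_mul]
            push_cast
            ring
      _ ≤ √2 ^ (d + 1) * (t / √2 ^ (d + 1)) :=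
            mul_le_mul_of_nonneg_right (succ_le_sqrt_two_pow hd) (by positivity)
      _ = t := mul_div_cancel₀ _ hp.ne'

end Comparability

lemma self_le_choose {n k : ℕ} (hk : 0 < k) (hkn : k < n) : n ≤ n.choose k := by
  induction n generalizing k with
  | zero => omega
  | succ n ih =>
    obtain ⟨k, rfl⟩ := Nat.exists_eq_add_of_lt hk
    rw [zero_add, Nat.choose_succ_succ']
    rcases Nat.eq_zero_or_pos k with rfl | hk
    · simp [add_comm]
    · have := ih hk (by omega)
      have := Nat.choose_pos (show k + 1 ≤ n by omega)
      omega

section Lubell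

variable {α : Type*} [Fintype α] [DecidableEq α]

open Numbering Nat

lemma card_prefixed_inter_prefixed_le {A B : Finset α} (hAB : A ⊆ B) :
    #(prefixed A ∩ prefixed B) ≤ (#A)! * ((#B - #A)! * (Fintype.card α - #B)!) := by
  have hA : Fintype.card ↥(Aᶜ) = Fintype.card α - #A := by simp
  set B' : Finset ↥(Aᶜ) := univ.filter fun x => x.1 ∈ B with hB'
  have hcB : #B' = #B - #A := by
    rw [← card_sdiff_of_subset hAB]
    refine card_bij (fun x _ => x.1) (fun x hx => ?_) (fun x _ y _ h => Subtype.ext h)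
      fun y hy => ?_
    · exact mem_sdiff.2 ⟨(mem_filter.1 hx).2, mem_compl.1 x.2⟩
    · rw [mem_sdiff] at hy
      exact ⟨⟨y, mem_compl.2 hy.2⟩, by simp [hB', hy.1], rfl⟩
  have hle := card_le_card hAB
  have hBn := card_le_univ B
  have htarget : #((univ : Finset (Numbering A)) ×ˢ prefixed B') =
      (#A)! * ((#B - #A)! * (Fintype.card α - #B)!) := by
    rw [card_product, card_prefixed, hcB, hA, Finset.card_univ, Fintype.card_numbering]
    congr 3
    · simp
    · omega
  rw [← htarget]
  refine card_le_card_of_injOn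
    (fun f => if h : f ∈ prefixed A then prefixedEquiv A ⟨f, h⟩ else
      (Fintype.equivFin _, Fintype.equivFin _)) (fun f hf => ?_) fun f hf g hg h => ?_
  · rw [mem_coe, mem_inter] at hf
    simp only [hf.1, dif_pos, mem_coe, mem_product, mem_univ, true_and, mem_prefixed]
    intro x
    have h₁ := (mem_prefixed.1 hf.2) x.1
    have h₂ := (mem_prefixed.1 hf.1) x.1
    have h₃ := mem_compl.1 x.2
    simp only [hB', mem_filter, mem_univ, true_and] at hcB ⊢
    rw [h₁, hcB]
    simp only [prefixedEquiv, Equiv.coe_fn_mk]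
    rw [h₂] at h₃
    omega
  · rw [mem_coe, mem_inter] at hf hg
    simp only [hf.1, hg.1, dif_pos] at h
    exact congrArg Subtype.val ((prefixedEquiv A).injective h)

lemma card_sub_mul_card_prefixed_inter_le {A B : Finset α} (hAB : A ⊂ B)
    (hB : #B < Fintype.card α) :
    (Fintype.card α - #A) * #(prefixed A ∩ prefixed B) ≤ #(prefixed A) := by
  have hlt := card_lt_card hAB
  refine (Nat.mul_le_mul_left _ (card_prefixed_inter_prefixed_le hAB.1)).trans ?_
  rw [card_prefixed]
  set n := Fintype.card α
  have hch := Nat.choose_mul_factorial_mul_factorial (show #B - #A ≤ n - #A by omega)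
  rw [show n - #A - (#B - #A) = n - #B by omega] at hch
  have hle : n - #A ≤ (n - #A).choose (#B - #A) :=
    self_le_choose (by omega) (by omega)
  calc _ = (#A)! * ((n - #A) * (#B - #A)! * (n - #B)!) := by ring
    _ ≤ (#A)! * ((n - #A).choose (#B - #A) * (#B - #A)! * (n - #B)!) := by gcongr
    _ = _ := by rw [hch]

lemma card_filter_prefixed_le (W : Finset (Finset α)) (f : Numbering α) :
    #{A ∈ W | f ∈ prefixed A} ≤
      1 + #{p ∈ W ×ˢ W | p.1 ⊂ p.2 ∧ f ∈ prefixed p.1 ∩ prefixed p.2} := by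
  rcases ({A ∈ W | f ∈ prefixed A}).eq_empty_or_nonempty with h | h
  · rw [h, card_empty]
    exact Nat.zero_le _
  obtain ⟨A, hA, hmin⟩ := exists_min_image _ (fun A => #A) h
  rw [mem_filter] at hA
  rw [← card_erase_add_one (mem_filter.2 hA), add_comm]
  refine Nat.add_le_add_left (card_le_card_of_injOn (fun B => (A, B)) (fun B hB => ?_)
    fun B _ C _ h => (Prod.mk.inj h).2) 1
  rw [mem_coe, mem_erase, mem_filter] at hB
  simp only [mem_coe, mem_filter, mem_product, mem_inter]
  have hsub : A ⊆ B := (mem_prefixed.1 hA.2).subset_of_card_le_card (mem_prefixed.1 hB.2.2)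
    (hmin B (mem_filter.2 hB.2))
  exact ⟨⟨hA.1, hB.2.1⟩, ssubset_of_subset_of_ne hsub hB.1.symm, hA.2, hB.2.2⟩

lemma sum_card_prefixed_le (W : Finset (Finset α)) :
    ∑ A ∈ W, #(prefixed A) ≤ (Fintype.card α)! +
      ∑ A ∈ W, ∑ B ∈ W with A ⊂ B, #(prefixed A ∩ prefixed B) := by
  have h := sum_le_sum fun f (_ : f ∈ (univ : Finset (Numbering α))) => card_filter_prefixed_le W f
  rw [sum_add_distrib, sum_const, Finset.card_univ, Fintype.card_numbering, smul_eq_mul, mul_one] at h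
  calc ∑ A ∈ W, #(prefixed A) = ∑ f : Numbering α, #{A ∈ W | f ∈ prefixed A} := by
        simp_rw [card_filter]
        rw [sum_comm]
        refine sum_congr rfl fun A _ => ?_
        rw [← card_filter]
        congr 1
        ext f
        simp
    _ ≤ _ := h
    _ = _ := by
        congr 1
        simp_rw [card_filter]
        rw [sum_comm, sum_product]
        refine sum_congr rfl fun A _ => ?_
        rw [sum_filter]
        refine sum_congr rfl fun B _ => ?_
        by_cases hAB : A ⊂ B
        · simp only [hAB, true_and, if_true]
          rw [← card_filter]
          congr 1
          ext f
          simp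
        · simp [hAB]

/-- A supersaturated form of the Lubell–Yamamoto–Meshalkin inequality: a family in which every
set has few strict supersets is hardly larger than the middle layer. -/
theorem sub_mul_card_le_mul_choose {W : Finset (Finset α)} {d : ℕ}
    (hcard : ∀ A ∈ W, 4 * #A ≤ 3 * Fintype.card α)
    (hdeg : ∀ A ∈ W, #{B ∈ W | A ⊂ B} ≤ d) :
    (Fintype.card α - 4 * d) * #W ≤
      Fintype.card α * (Fintype.card α).choose (Fintype.card α / 2) := by
  set n := Fintype.card α with hn
  rcases Nat.eq_zero_or_pos n with h0 | h0
  · simp [h0]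
  set σ := ∑ A ∈ W, #(prefixed A) with hσ
  have hpair : ∀ A ∈ W, n * ∑ B ∈ W with A ⊂ B, #(prefixed A ∩ prefixed B) ≤
      4 * d * #(prefixed A) := fun A hA => by
    rw [mul_sum]
    calc _ ≤ ∑ B ∈ W with A ⊂ B, 4 * #(prefixed A) := sum_le_sum fun B hB => by
          rw [mem_filter] at hB
          have h₁ := hcard A hA
          have h₂ := hcard B hB.1
          have h₃ := card_sub_mul_card_prefixed_inter_le hB.2 (by omega)
          refine le_trans ?_ (Nat.mul_le_mul_left 4 h₃)
          rw [← mul_assoc]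
          exact Nat.mul_le_mul_right _ (by omega)
      _ ≤ _ := by
          rw [sum_const, smul_eq_mul]
          calc _ ≤ d * (4 * #(prefixed A)) := Nat.mul_le_mul_right _ (hdeg A hA)
            _ = _ := by ring
  have hmain : n * σ ≤ n * n ! + 4 * d * σ := by
    refine (Nat.mul_le_mul_left n (sum_card_prefixed_le W)).trans ?_
    rw [mul_add, mul_sum, hσ, mul_sum W _ (4 * d)]
    exact Nat.add_le_add_left (sum_le_sum hpair) _
  have hWσ : #W * n ! ≤ n.choose (n / 2) * σ := by
    rw [hσ, mul_sum, ← smul_eq_mul, ← sum_const]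
    refine sum_le_sum fun A _ => ?_
    rw [card_prefixed, ← Nat.choose_mul_factorial_mul_factorial (card_le_univ A), mul_assoc]
    exact Nat.mul_le_mul_right _ (Nat.choose_le_middle _ _)
  have hmain' : (n - 4 * d) * σ ≤ n * n ! := by
    rw [Nat.sub_mul]
    omega
  refine Nat.le_of_mul_le_mul_right (c := n !) ?_ (Nat.factorial_pos n)
  calc (n - 4 * d) * #W * n ! = (n - 4 * d) * (#W * n !) := by ring
    _ ≤ (n - 4 * d) * (n.choose (n / 2) * σ) := Nat.mul_le_mul_left _ hWσ
    _ = n.choose (n / 2) * ((n - 4 * d) * σ) := by ring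
    _ ≤ n.choose (n / 2) * (n * n !) := Nat.mul_le_mul_left _ hmain'
    _ = _ := by ring

end Lubell

section Counting

variable {V : Type*} [DecidableEq V] {G : SimpleGraph V} [DecidableRel G.Adj] {S : Finset V}

lemma card_maximalIndepSets_le_sum_of_cover {𝒞 : Finset (Finset V)} (hS : ∀ C ∈ 𝒞, C ⊆ S)
    (hcov : ∀ I ⊆ S, (∀ a ∈ I, ∀ b ∈ I, ¬ G.Adj a b) → ∃ C ∈ 𝒞, I ⊆ C) :
    #(G.maximalIndepSets S) ≤ ∑ C ∈ 𝒞, #(G.maximalIndepSets C) := by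
  refine (card_le_card fun I hI => ?_).trans card_biUnion_le
  obtain ⟨hIS, hind, -⟩ := mem_maximalIndepSets.1 hI
  obtain ⟨C, hC, hIC⟩ := hcov I hIS hind
  exact mem_biUnion.2 ⟨C, hC, maximalIndepSets_mono_mem hI hIC (hS C hC)⟩

lemma card_maximalIndepSets_le_of_containers {d : ℕ} {y b : ℝ} (hy : 1 ≤ y)
    (hd : y ^ d + 1 ≤ y ^ (d + 1)) (hb : 0 ≤ b)
    (h : ∀ C ⊆ S, (∀ v ∈ C, #(G.neighborsIn C v) ≤ d) → (#(G.maximalIndepSets C) : ℝ) ≤ b) :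
    (#(G.maximalIndepSets S) : ℝ) ≤ y ^ #S * b := by
  obtain ⟨𝒞, h₁, h₂, h₃⟩ := exists_containers (G := G) hy hd S
  calc (#(G.maximalIndepSets S) : ℝ) ≤ ∑ C ∈ 𝒞, (#(G.maximalIndepSets C) : ℝ) := by
        exact_mod_cast card_maximalIndepSets_le_sum_of_cover (fun C hC => (h₁ C hC).1) h₂
    _ ≤ ∑ C ∈ 𝒞, b := sum_le_sum fun C hC => h C (h₁ C hC).1 (h₁ C hC).2
    _ = #𝒞 * b := by rw [sum_const, nsmul_eq_mul]
    _ ≤ _ := mul_le_mul_of_nonneg_right h₃ hb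

/-- Splitting off an arbitrary set `T` of vertices costs at most a factor `2 ^ #T`. -/
lemma card_maximalIndepSets_le_two_pow_mul (T : Finset V) {b : ℝ}
    (h : ∀ C ⊆ S \ T, (#(G.maximalIndepSets C) : ℝ) ≤ b) :
    (#(G.maximalIndepSets S) : ℝ) ≤ 2 ^ #T * b := by
  have hfib := card_eq_sum_card_fiberwise (s := G.maximalIndepSets S) (t := T.powerset)
    (f := fun I => I ∩ T) fun I _ => mem_coe.2 (mem_powerset.2 inter_subset_right)
  calc (#(G.maximalIndepSets S) : ℝ)
      = ∑ J ∈ T.powerset, (#{I ∈ G.maximalIndepSets S | I ∩ T = J} : ℝ) := by exact_mod_cast hfib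
    _ ≤ ∑ J ∈ T.powerset, b := sum_le_sum fun J _ => ?_
    _ = _ := by rw [sum_const, card_powerset, nsmul_eq_mul]; push_cast; rfl
  refine le_trans ?_ (h {x ∈ S \ T | ∀ y ∈ J, ¬ G.Adj y x} (filter_subset _ _))
  refine Nat.cast_le.2 (card_le_card_of_injOn (fun I => I \ T) (fun I hI => ?_)
    fun I hI I' hI' heq => ?_)
  · rw [mem_coe, mem_filter, mem_maximalIndepSets] at hI
    obtain ⟨⟨hIS, hind, hmax⟩, rfl⟩ := hI
    refine mem_maximalIndepSets.2 ⟨fun x hx => ?_, fun a ha b hb =>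
      hind a (mem_sdiff.1 ha).1 b (mem_sdiff.1 hb).1, fun x hx hxI => ?_⟩
    · have hx := mem_sdiff.1 hx
      exact mem_filter.2 ⟨mem_sdiff.2 ⟨hIS hx.1, hx.2⟩,
        fun y hy => hind y (mem_inter.1 hy).1 x hx.1⟩
    · rw [mem_filter, mem_sdiff] at hx
      obtain ⟨u, hu, hux⟩ := hmax x hx.1.1 fun hI => hxI (mem_sdiff.2 ⟨hI, hx.1.2⟩)
      exact ⟨u, mem_sdiff.2 ⟨hu, fun huT => hx.2 u (mem_inter.2 ⟨hu, huT⟩) hux⟩, hux⟩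
  · rw [mem_coe, mem_filter] at hI hI'
    rw [← sdiff_union_inter I T, ← sdiff_union_inter I' T, hI.2, hI'.2]
    exact congrArg (· ∪ J) heq

end Counting

section BooleanLattice

variable {α : Type*} [DecidableEq α]

lemma card_filter_ssubset_diamondHull_le {S : Finset (Finset α)} {d : ℕ}
    (hdeg : ∀ A ∈ S, #((comparability α).neighborsIn S A) ≤ d) {E : Finset α}
    (hE : E ∈ diamondHull S) : #{F ∈ diamondHull S | E ⊂ F} ≤ d * (d ^ 2 + 1) := by
  obtain ⟨A, hA, hAE⟩ : ∃ A ∈ S, A ⊆ E := by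
    rcases eq_or_between_of_mem_diamondHull hE with h | ⟨A, hA, C, hC, hAE, hEC⟩
    exacts [⟨E, h, subset_rfl⟩, ⟨A, hA, hAE.1⟩]
  set N := (comparability α).neighborsIn S with hN
  have hsub : {F ∈ diamondHull S | E ⊂ F} ⊆ (N A).biUnion fun C =>
      insert C ((N C ×ˢ N C).image fun p => p.1 ∪ C \ p.2) := by
    intro F hF
    rw [mem_filter, mem_diamondHull] at hF
    obtain ⟨hF, hEF⟩ := hF
    have hAF : A ⊂ F := hAE.trans_ssubset hEF
    rw [mem_biUnion]
    rcases hF with hF | ⟨X, hX, B, hB, C, hC, hXB, hBC, rfl⟩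
    · exact ⟨F, mem_neighborsIn.2 ⟨hF, Or.inl hAF⟩, mem_insert_self _ _⟩
    · refine ⟨C, mem_neighborsIn.2 ⟨hC, Or.inl (hAF.trans (union_sdiff_ssubset hXB hBC))⟩,
        mem_insert_of_mem (mem_image.2 ⟨(X, B), mem_product.2 ⟨?_, ?_⟩, rfl⟩)⟩
      · exact mem_neighborsIn.2 ⟨hX, Or.inr (hXB.trans hBC)⟩
      · exact mem_neighborsIn.2 ⟨hB, Or.inr hBC⟩
  refine (card_le_card hsub).trans ((card_biUnion_le_card_mul _ _ (d ^ 2 + 1) fun C hC => ?_).trans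
    (Nat.mul_le_mul_right _ (hdeg A hA)))
  refine (card_insert_le _ _).trans (Nat.add_le_add_right (card_image_le.trans ?_) 1)
  have := hdeg C (mem_neighborsIn.1 hC).1
  rw [card_product, sq]
  exact Nat.mul_le_mul this this

lemma sum_powerset_two_mul_card_sub_sq (s : Finset α) :
    ∑ t ∈ s.powerset, (2 * (#t : ℤ) - #s) ^ 2 = (#s : ℤ) * 2 ^ #s := by
  induction s using Finset.induction_on with
  | empty => simp
  | insert a s ha ih =>
    rw [sum_powerset_insert ha, ← sum_add_distrib, card_insert_of_notMem ha]
    have : ∀ t ∈ s.powerset, (2 * (#t : ℤ) - (#s + 1 : ℕ)) ^ 2 +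
        (2 * (#(insert a t) : ℤ) - (#s + 1 : ℕ)) ^ 2 = 2 * (2 * (#t : ℤ) - #s) ^ 2 + 2 := by
      intro t ht
      rw [card_insert_of_notMem fun h => ha (mem_powerset.1 ht h)]
      push_cast
      ring
    rw [sum_congr rfl this, sum_add_distrib, ← mul_sum, ih, sum_const, card_powerset]
    push_cast
    ring

variable [Fintype α]

/-- Chebyshev's bound for the number of sets containing more than three quarters of the
elements. -/
lemma mul_card_large_sets_le :
    Fintype.card α * #{A : Finset α | 3 * Fintype.card α < 4 * #A} ≤ 4 * 2 ^ Fintype.card α := by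
  set n := Fintype.card α with hn
  rcases Nat.eq_zero_or_pos n with h0 | h0
  · simp [h0]
  have h := sum_powerset_two_mul_card_sub_sq (univ : Finset α)
  rw [powerset_univ, Finset.card_univ, ← hn] at h
  have hle : ∑ A : Finset α with 3 * n < 4 * #A, (n : ℤ) ^ 2 ≤ 4 * (n * 2 ^ n) := by
    rw [← h, mul_sum]
    refine (sum_le_sum fun A hA => ?_).trans
      (sum_le_sum_of_subset_of_nonneg (filter_subset _ _) fun A _ _ => by positivity)
    have := (mem_filter.1 hA).2
    have h' : (3 : ℤ) * n < 4 * #A := by exact_mod_cast this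
    nlinarith
  rw [sum_const, nsmul_eq_mul] at hle
  have hle' : #{A : Finset α | 3 * n < 4 * #A} * n ^ 2 ≤ 4 * (n * 2 ^ n) := by exact_mod_cast hle
  refine Nat.le_of_mul_le_mul_left ?_ h0
  linarith

lemma card_maximalIndepSets_univ_le {d₁ d₂ K : ℕ} {y₁ y₂ : ℝ} (hy₁ : 1 ≤ y₁) (hy₂ : 1 ≤ y₂)
    (h₁ : y₁ ^ d₁ + 1 ≤ y₁ ^ (d₁ + 1)) (h₂ : y₂ ^ d₂ + 1 ≤ y₂ ^ (d₂ + 1))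
    (hn : 0 < Fintype.card α) (hd₁ : 8 * d₁ ≤ Fintype.card α)
    (hK : ∀ m, (Fintype.card α - 4 * (d₂ * (d₂ ^ 2 + 1))) * m ≤
      Fintype.card α * (Fintype.card α).choose (Fintype.card α / 2) → m ≤ K) :
    (#((comparability α).maximalIndepSets univ) : ℝ) ≤
      2 ^ #{A : Finset α | 3 * Fintype.card α < 4 * #A} * (y₁ ^ (2 ^ Fintype.card α) *
        (y₂ ^ (2 * (Fintype.card α).choose (Fintype.card α / 2)) * √2 ^ K)) := by
  set n := Fintype.card α with hn'
  have hy₁0 : 0 < y₁ := by linarith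
  have hy₂0 : 0 < y₂ := by linarith
  refine card_maximalIndepSets_le_two_pow_mul _ fun S hS => ?_
  have hS : ∀ A ∈ S, 4 * #A ≤ 3 * n := fun A hA => by simpa using hS hA
  refine (card_maximalIndepSets_le_of_containers hy₁ h₁
    (b := y₂ ^ (2 * n.choose (n / 2)) * √2 ^ K) (by positivity) fun C hC hCd => ?_).trans
    (mul_le_mul_of_nonneg_right (pow_le_pow_right₀ hy₁ ?_) (by positivity))
  · have hCcard : #C ≤ 2 * n.choose (n / 2) := by
      have := sub_mul_card_le_mul_choose (W := C) (d := d₁) (fun A hA => hS A (hC hA))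
        fun A hA => (card_le_card fun B hB => ?_).trans (hCd A hA)
      · refine Nat.le_of_mul_le_mul_left ?_ hn
        have h' : n * #C ≤ 2 * ((n - 4 * d₁) * #C) := by
          rw [← mul_assoc]
          exact Nat.mul_le_mul_right _ (by omega)
        refine h'.trans ((Nat.mul_le_mul_left 2 this).trans (le_of_eq ?_))
        ring
      · rw [mem_filter] at hB
        exact mem_neighborsIn.2 ⟨hB.1, Or.inl hB.2⟩
    refine (card_maximalIndepSets_le_of_containers hy₂ h₂ (b := √2 ^ K) (by positivity)
      fun D hD hDd => ?_).trans
      (mul_le_mul_of_nonneg_right (pow_le_pow_right₀ hy₂ hCcard) (by positivity))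
    refine (card_maximalIndepSets_le_sqrt_two_pow D).trans
      (pow_le_pow_right₀ (Real.one_le_sqrt.2 (by norm_num)) (hK _ ?_))
    refine sub_mul_card_le_mul_choose (fun A hA => ?_)
      fun A hA => card_filter_ssubset_diamondHull_le hDd hA
    rcases eq_or_between_of_mem_diamondHull hA with h | ⟨_, _, B, hB, -, hAB⟩
    · exact hS A (hC (hD h))
    · have := hS B (hC (hD hB))
      have := card_lt_card hAB
      omega
  · refine (card_le_univ S).trans ?_
    simp [hn']

lemma two_pow_choose_le_card_maximalIndepSets_univ (x : α) (k : ℕ) :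
    2 ^ (Fintype.card α - 1).choose k ≤ #((comparability α).maximalIndepSets univ) := by
  set L := powersetCard k (univ.erase x) with hL
  have hx : ∀ A ∈ L, x ∉ A := fun A hA h =>
    notMem_erase x univ ((mem_powersetCard.1 hA).1 h)
  have hcard : ∀ A ∈ L, #A = k := fun A hA => (mem_powersetCard.1 hA).2
  have hsub : ∀ A ∈ L, ∀ B ∈ L, A ⊆ B → A = B := fun A hA B hB h =>
    eq_of_subset_of_card_le h (by rw [hcard A hA, hcard B hB])
  have hext : ∀ J ⊆ L, ∃ I ∈ (comparability α).maximalIndepSets univ,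
      J.image (insert x) ∪ L \ J ⊆ I := by
    intro J hJ
    refine exists_maximalIndepSets_superset (subset_univ _) ?_
    have key : ∀ a ∈ J.image (insert x) ∪ L \ J, ∀ b ∈ J.image (insert x) ∪ L \ J, ¬ a ⊂ b := by
      intro a ha b hb hab
      rw [mem_union, mem_image, mem_sdiff] at ha hb
      rcases ha with ⟨A, hA, rfl⟩ | ⟨ha, haJ⟩ <;> rcases hb with ⟨B, hB, rfl⟩ | ⟨hb, hbJ⟩
      · have := card_lt_card hab
        rw [card_insert_of_notMem (hx A (hJ hA)), card_insert_of_notMem (hx B (hJ hB)),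
          hcard A (hJ hA), hcard B (hJ hB)] at this
        exact lt_irrefl _ this
      · exact hx b hb (hab.1 (mem_insert_self _ _))
      · have : a ⊆ B := (subset_insert_iff_of_notMem (hx a ha)).1 hab.1
        exact haJ (hsub a ha B (hJ hB) this ▸ hB)
      · exact hab.ne (hsub a ha b hb hab.1)
    exact fun a ha b hb h => h.elim (key a ha b hb) (key b hb a ha)
  choose! f hf hfsub using hext
  have hmono : ∀ J ⊆ L, ∀ J' ⊆ L, f J = f J' → J ⊆ J' := by
    intro J hJ J' hJ' h A hA
    by_contra hA'
    have h₁ : insert x A ∈ f J := hfsub J hJ (mem_union_left _ (mem_image_of_mem _ hA))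
    have h₂ : A ∈ f J := h ▸ hfsub J' hJ' (mem_union_right _ (mem_sdiff.2 ⟨hJ hA, hA'⟩))
    exact (mem_maximalIndepSets.1 (hf J hJ)).2.1 A h₂ _ h₁
      (Or.inl (ssubset_insert (hx A (hJ hA))))
  have hcardL : #L = (Fintype.card α - 1).choose k := by
    rw [hL, card_powersetCard, card_erase_of_mem (mem_univ x), Finset.card_univ]
  rw [← hcardL, ← card_powerset]
  refine card_le_card_of_injOn f (fun J hJ => hf J (mem_powerset.1 hJ)) fun J hJ J' hJ' h => ?_
  rw [mem_coe, mem_powerset] at hJ hJ'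
  exact (hmono J hJ J' hJ' h).antisymm (hmono J' hJ' J hJ h.symm)

end BooleanLattice

end SimpleGraph

lemma ma_eq_card_maximalIndepSets (n : ℕ) :
    ma n = #((SimpleGraph.comparability (Fin n)).maximalIndepSets univ) := by
  rw [ma, ← Set.ncard_coe_finset, ← Set.ncard_image_of_injective _ Finset.coe_injective]
  congr 1
  ext A
  obtain ⟨I, rfl⟩ := A.toFinite.exists_finset_coe
  rw [Set.mem_ofPred_eq, Set.mem_image]
  simp only [Finset.coe_inj, exists_eq_right, mem_coe]
  rw [SimpleGraph.mem_maximalIndepSets]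
  have hadj : ∀ A B : Finset (Fin n), A ≠ B → A ⊆ B → (SimpleGraph.comparability _).Adj A B :=
    fun A B h₁ h₂ => Or.inl (ssubset_of_subset_of_ne h₂ h₁)
  constructor
  · rintro ⟨hanti, hmax⟩
    refine ⟨subset_univ _, fun a ha b hb h => ?_, fun v _ hv => ?_⟩
    · rcases h with h | h
      · exact hanti ha hb h.ne h.1
      · exact hanti hb ha h.ne h.1
    · by_contra! hcon
      refine hv (hmax (y := insert v (I : Set (Finset (Fin n)))) ?_ (Set.subset_insert _ _)
        (Set.mem_insert _ _))
      refine hanti.insert (fun b hb hne hbv => ?_) fun b hb hne hvb => ?_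
      · exact hcon b hb (hadj b v hne.symm hbv)
      · exact hcon b hb (hadj v b hne hvb).symm
  · rintro ⟨-, hind, hdom⟩
    refine ⟨fun a ha b hb hne hab => hind a ha b hb (hadj a b hne hab), fun J hJ hIJ v hv => ?_⟩
    by_contra hvI
    obtain ⟨u, hu, huv⟩ := hdom v (mem_univ v) hvI
    rcases huv with h | h
    · exact hJ (hIJ hu) hv h.ne h.1
    · exact hJ hv (hIJ hu) h.ne h.1

lemma sixteen_pow_le_mul_centralBinom_sq {m : ℕ} (hm : 1 ≤ m) :
    16 ^ m ≤ 4 * m * m.centralBinom ^ 2 := by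
  induction m, hm using Nat.le_induction with
  | base => simp [Nat.centralBinom]
  | succ m hm ih =>
    have h := Nat.succ_mul_centralBinom_succ m
    refine Nat.le_of_mul_le_mul_left ?_ (show 0 < m + 1 by omega)
    calc (m + 1) * 16 ^ (m + 1) = 16 * (m + 1) * 16 ^ m := by ring
      _ ≤ 16 * (m + 1) * (4 * m * m.centralBinom ^ 2) := Nat.mul_le_mul_left _ ih
      _ ≤ 4 * (2 * (2 * m + 1) * m.centralBinom) ^ 2 := by
        have : 4 * m * (m + 1) ≤ (2 * m + 1) ^ 2 := by nlinarith
        nlinarith [Nat.mul_le_mul_right (16 * m.centralBinom ^ 2) this]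
      _ = _ := by rw [← h]; ring

lemma two_pow_sq_le_mul_choose_sq {n : ℕ} (hn : 1 ≤ n) :
    (2 ^ n) ^ 2 ≤ 4 * n * n.choose (n / 2) ^ 2 := by
  rcases Nat.even_or_odd' n with ⟨m, rfl | rfl⟩
  · have := sixteen_pow_le_mul_centralBinom_sq (show 1 ≤ m by omega)
    rw [Nat.mul_div_cancel_left m two_pos, ← Nat.centralBinom, ← pow_mul,
      show 2 * m * 2 = 4 * m by ring, pow_mul]
    norm_num
    nlinarith
  · have h := sixteen_pow_le_mul_centralBinom_sq (show 1 ≤ m + 1 by omega)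
    have hc : (m + 1).centralBinom = 2 * (2 * m + 1).choose m := by
      rw [Nat.centralBinom, show 2 * (m + 1) = 2 * m + 1 + 1 by ring, Nat.choose_succ_succ',
        Nat.choose_symm_half]
      ring
    rw [hc] at h
    rw [show (2 * m + 1) / 2 = m by omega]
    have : 4 * (2 ^ (2 * m + 1)) ^ 2 = 16 ^ (m + 1) := by
      rw [← pow_mul, show (2 * m + 1) * 2 = 4 * m + 2 by ring, pow_add, pow_mul]
      norm_num
      ring
    nlinarith [Nat.zero_le (m * (2 * m + 1).choose m ^ 2)]

lemma choose_half_le_two_mul {n : ℕ} (hn : 1 ≤ n) :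
    n.choose (n / 2) ≤ 2 * (n - 1).choose (n / 2) := by
  obtain ⟨m, rfl⟩ : ∃ m, n = m + 1 := ⟨n - 1, by omega⟩
  rw [Nat.add_sub_cancel]
  rcases Nat.even_or_odd' m with ⟨k, rfl | rfl⟩
  · rw [show (2 * k + 1) / 2 = k by omega]
    rcases Nat.eq_zero_or_pos k with rfl | hk
    · simp
    obtain ⟨j, rfl⟩ : ∃ j, k = j + 1 := ⟨k - 1, by omega⟩
    rw [Nat.choose_succ_succ']
    have := Nat.choose_le_middle j (2 * (j + 1))
    rw [Nat.mul_div_cancel_left _ two_pos] at this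
    omega
  · rw [show (2 * k + 1 + 1) / 2 = k + 1 by omega, Nat.choose_succ_succ', Nat.choose_symm_half]
    omega

lemma pow_add_one_le_pow_succ {q k : ℕ} (hq : 0 < q) (hk : q ≤ 2 ^ k) :
    (1 + 1 / (q : ℝ)) ^ (q * k) + 1 ≤ (1 + 1 / (q : ℝ)) ^ (q * k + 1) := by
  have hq0 : (0 : ℝ) < q := by exact_mod_cast hq
  have h2 : (2 : ℝ) ≤ (1 + 1 / (q : ℝ)) ^ q := by
    have := one_add_mul_le_pow (a := 1 / (q : ℝ)) (by linarith [one_div_pos.2 hq0]) q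
    rwa [mul_one_div_cancel hq0.ne', one_add_one_eq_two] at this
  have hle : (q : ℝ) ≤ (1 + 1 / (q : ℝ)) ^ (q * k) := by
    rw [pow_mul]
    exact le_trans (by exact_mod_cast hk) (pow_le_pow_left₀ (by norm_num) h2 k)
  rw [pow_succ, mul_add, mul_one, mul_one_div]
  gcongr
  exact (one_le_div hq0).2 hle

lemma logb_two_one_add_le {x : ℝ} (hx : 0 ≤ x) : Real.logb 2 (1 + x) ≤ 2 * x := by
  have h2 := Real.log_two_gt_d9
  rw [Real.logb, div_le_iff₀ (by linarith)]
  have := Real.log_le_sub_one_of_pos (show 0 < 1 + x by linarith)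
  nlinarith

lemma mul_pow_three_le_two_pow {k : ℕ} (hk : 32 ≤ k) : 32768 * k ^ 3 ≤ 2 ^ k := by
  induction k, hk using Nat.le_induction with
  | base => norm_num
  | succ k hk ih =>
    rw [pow_succ 2 k]
    have : (k + 1) ^ 3 ≤ 2 * k ^ 3 := by nlinarith [Nat.mul_le_mul hk (le_refl (k ^ 2))]
    omega

lemma pow_three_le_two_pow_div {s : ℕ} (hs : 512 ≤ s) : s ^ 3 ≤ 2 ^ (s / 16) := by
  refine le_trans ?_ (mul_pow_three_le_two_pow (by omega))
  calc s ^ 3 ≤ (32 * (s / 16)) ^ 3 := Nat.pow_le_pow_left (by omega) 3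
    _ = _ := by ring

lemma logb_ma_le {n s t : ℕ} (hs : 512 ≤ s) (ht : 0 < t) (hts : t * t ≤ s) (hsn : s ^ 4 ≤ n)
    (hns : n ≤ 16 * s ^ 4) :
    Real.logb 2 (ma n) ≤ n.choose (n / 2) *
      (32 / (s : ℝ) ^ 2 + 16 / s + 4 / t + 1 / 2 / (1 - 8 / (s : ℝ))) := by
  have hn : 0 < n := lt_of_lt_of_le (by positivity) hsn
  set N := n.choose (n / 2) with hN
  set D := t * t * ((t * t) ^ 2 + 1) with hD
  set T := #{A : Finset (Fin n) | 3 * n < 4 * #A} with hT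
  have hs0 : (0 : ℝ) < s := by exact_mod_cast (by omega : 0 < s)
  have hs8 : 0 < 1 - 8 / (s : ℝ) := by
    rw [sub_pos, div_lt_one hs0]
    exact_mod_cast (by omega : 8 < s)
  have ht0 : (0 : ℝ) < t := by exact_mod_cast ht
  have hn0 : (0 : ℝ) < n := by exact_mod_cast hn
  have hsn' : (s : ℝ) ^ 4 ≤ n := by exact_mod_cast hsn
  have hD4 : 4 * D ≤ 8 * s ^ 3 := by
    have h1 : (t * t) ^ 2 + 1 ≤ 2 * s ^ 2 := by
      have := Nat.pow_le_pow_left hts 2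
      have : 0 < s ^ 2 := by positivity
      omega
    have := Nat.mul_le_mul hts h1
    rw [hD]
    nlinarith
  have hDn : (n : ℝ) * (1 - 8 / s) ≤ n - 4 * D := by
    have h1 : (4 * D : ℝ) ≤ 8 * s ^ 3 := by exact_mod_cast hD4
    have h2 : (8 * s ^ 3 : ℝ) ≤ n * (8 / s) := by
      rw [mul_div_assoc', le_div_iff₀ hs0]
      nlinarith
    linarith
  have hDlt : 4 * D < n := by
    have : (0 : ℝ) < n - 4 * D := lt_of_lt_of_le (by positivity) hDn
    exact_mod_cast (by linarith : (4 * D : ℝ) < n)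
  set K := n * N / (n - 4 * D) with hK
  have hKle : (K : ℝ) ≤ N / (1 - 8 / s) := by
    rw [le_div_iff₀ hs8]
    have h1 : ((K * (n - 4 * D) : ℕ) : ℝ) ≤ (n * N : ℕ) := by
      exact_mod_cast Nat.div_mul_le_self _ _
    push_cast [Nat.cast_sub hDlt.le] at h1
    have h2 := mul_le_mul_of_nonneg_left hDn (Nat.cast_nonneg (α := ℝ) K)
    refine le_of_mul_le_mul_left ?_ hn0
    linarith
  have hpow : (2 : ℝ) ^ n ≤ 8 * s ^ 2 * N := by
    have h : (2 ^ n) ^ 2 ≤ (8 * s ^ 2 * N) ^ 2 := by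
      calc _ ≤ 4 * n * N ^ 2 := two_pow_sq_le_mul_choose_sq hn
        _ ≤ 4 * (16 * s ^ 4) * N ^ 2 := by gcongr
        _ = _ := by ring
    exact_mod_cast (Nat.pow_le_pow_iff_left two_ne_zero).1 h
  have hTle : (T : ℝ) ≤ N * (32 / s ^ 2) := by
    have h := SimpleGraph.mul_card_large_sets_le (α := Fin n)
    simp only [Fintype.card_fin] at h
    have h : (n * T : ℝ) ≤ 4 * 2 ^ n := by exact_mod_cast h
    rw [mul_div_assoc', le_div_iff₀ (by positivity)]
    refine le_of_mul_le_mul_right ?_ (show (0 : ℝ) < s ^ 2 by positivity)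
    have := mul_le_mul_of_nonneg_right hsn' (Nat.cast_nonneg (α := ℝ) T)
    nlinarith
  have hbound := SimpleGraph.card_maximalIndepSets_univ_le (α := Fin n) (d₁ := s ^ 3 * (s / 16))
    (d₂ := t * t) (K := K) (y₁ := 1 + 1 / ((s ^ 3 : ℕ) : ℝ)) (y₂ := 1 + 1 / (t : ℝ))
    (by linarith [show (0 : ℝ) ≤ 1 / ((s ^ 3 : ℕ) : ℝ) by positivity])
    (by linarith [one_div_pos.2 ht0])
    (pow_add_one_le_pow_succ (by positivity) (pow_three_le_two_pow_div hs))
    (pow_add_one_le_pow_succ ht Nat.lt_two_pow_self.le)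
    (by simpa using hn) (by
      rw [Fintype.card_fin]
      calc 8 * (s ^ 3 * (s / 16)) = s ^ 3 * (8 * (s / 16)) := by ring
        _ ≤ s ^ 3 * s := Nat.mul_le_mul_left _ (by omega)
        _ = s ^ 4 := by ring
        _ ≤ n := hsn)
    (fun m hm => by
      rw [Fintype.card_fin] at hm
      rw [hK, Nat.le_div_iff_mul_le (by omega), mul_comm]
      exact hm)
  rw [Fintype.card_fin, ← ma_eq_card_maximalIndepSets, ← hN, ← hT] at hbound
  have hpos : (0 : ℝ) < ma n := by
    rw [ma_eq_card_maximalIndepSets]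
    have := SimpleGraph.two_pow_choose_le_card_maximalIndepSets_univ (⟨0, hn⟩ : Fin n) 0
    exact_mod_cast lt_of_lt_of_le (by positivity) this
  have hlog := Real.logb_le_logb_of_le (b := 2) (by norm_num) hpos hbound
  have hy₁ : 0 < 1 + 1 / ((s ^ 3 : ℕ) : ℝ) := by positivity
  have hy₂ : 0 < 1 + 1 / (t : ℝ) := by positivity
  rw [Real.logb_mul (by positivity) (by positivity), Real.logb_mul (by positivity) (by positivity),
    Real.logb_mul (by positivity) (by positivity), Real.logb_pow, Real.logb_pow, Real.logb_pow,
    Real.logb_pow, Real.logb_self_eq_one (by norm_num), Real.sqrt_eq_rpow,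
    Real.logb_rpow (by norm_num) (by norm_num)] at hlog
  have hl₁ : ((2 ^ n : ℕ) : ℝ) * Real.logb 2 (1 + 1 / ((s ^ 3 : ℕ) : ℝ)) ≤ N * (16 / s) := by
    calc _ ≤ (8 * s ^ 2 * N : ℝ) * (2 * (1 / ((s ^ 3 : ℕ) : ℝ))) := by
          gcongr
          · exact Real.logb_nonneg (by norm_num)
              (by linarith [show (0 : ℝ) ≤ 1 / ((s ^ 3 : ℕ) : ℝ) by positivity])
          · exact_mod_cast hpow
          · exact logb_two_one_add_le (by positivity)
      _ = _ := by
          push_cast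
          field_simp
          ring
  have hl₂ : ((2 * N : ℕ) : ℝ) * Real.logb 2 (1 + 1 / (t : ℝ)) ≤ N * (4 / t) := by
    calc _ ≤ ((2 * N : ℕ) : ℝ) * (2 * (1 / (t : ℝ))) := by
          gcongr
          exact logb_two_one_add_le (by positivity)
      _ = _ := by
          push_cast
          ring
  calc _ ≤ _ := hlog
    _ ≤ N * (32 / (s : ℝ) ^ 2) + (N * (16 / s) + (N * (4 / t) + N / (1 - 8 / s) * (1 / 2))) := by
        rw [mul_one]
        gcongr
    _ = _ := by ring

lemma choose_le_logb_ma {n : ℕ} (hn : 0 < n) (k : ℕ) :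
    ((n - 1).choose k : ℝ) ≤ Real.logb 2 (ma n) := by
  have h := SimpleGraph.two_pow_choose_le_card_maximalIndepSets_univ (⟨0, hn⟩ : Fin n) k
  rw [Fintype.card_fin, ← ma_eq_card_maximalIndepSets] at h
  have h' : (2 : ℝ) ^ (n - 1).choose k ≤ ma n := by exact_mod_cast h
  have := Real.logb_le_logb_of_le (b := 2) (by norm_num) (by positivity) h'
  rwa [Real.logb_pow, Real.logb_self_eq_one (by norm_num), mul_one] at this

lemma tendsto_sqrt_atTop : Filter.Tendsto Nat.sqrt Filter.atTop Filter.atTop :=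
  Filter.tendsto_atTop.2 fun b => (Filter.eventually_ge_atTop (b * b)).mono
    fun _ h => Nat.le_sqrt.2 h

end MaximalAntichains

theorem log_ma_asymptotics :
    Filter.Tendsto
      (fun n : ℕ => Real.logb 2 (ma n) / ((n - 1).choose (n / 2) : ℝ))
      Filter.atTop (nhds 1) := by
  have hs : Filter.Tendsto (fun n : ℕ => n.sqrt.sqrt) Filter.atTop Filter.atTop :=
    tendsto_sqrt_atTop.comp tendsto_sqrt_atTop
  have ht : Filter.Tendsto (fun n : ℕ => n.sqrt.sqrt.sqrt) Filter.atTop Filter.atTop :=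
    tendsto_sqrt_atTop.comp hs
  have inv_s : ∀ c : ℝ, Filter.Tendsto (fun n : ℕ => c / (n.sqrt.sqrt : ℝ)) Filter.atTop
      (nhds 0) := fun c => (tendsto_const_div_atTop_nhds_zero_nat c).comp hs
  have inv_t : Filter.Tendsto (fun n : ℕ => 4 / (n.sqrt.sqrt.sqrt : ℝ)) Filter.atTop
      (nhds 0) := (tendsto_const_div_atTop_nhds_zero_nat 4).comp ht
  have inv_sq : Filter.Tendsto (fun n : ℕ => 32 / (n.sqrt.sqrt : ℝ) ^ 2) Filter.atTop
      (nhds 0) := by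
    have := (inv_s 32).mul (inv_s 1)
    simp only [mul_zero] at this
    refine this.congr fun n => ?_
    ring
  have hlim : Filter.Tendsto (fun n : ℕ => 2 * (32 / (n.sqrt.sqrt : ℝ) ^ 2 +
      16 / (n.sqrt.sqrt : ℝ) + 4 / (n.sqrt.sqrt.sqrt : ℝ) +
      1 / 2 / (1 - 8 / (n.sqrt.sqrt : ℝ)))) Filter.atTop (nhds 1) := by
    have hlast : Filter.Tendsto (fun n : ℕ => (1 / 2 : ℝ) / (1 - 8 / (n.sqrt.sqrt : ℝ)))
        Filter.atTop (nhds ((1 / 2) / (1 - 0))) :=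
      tendsto_const_nhds.div (tendsto_const_nhds.sub (inv_s 8)) (by norm_num)
    have := (((inv_sq.add (inv_s 16)).add inv_t).add hlast).const_mul 2
    norm_num at this ⊢
    exact this
  refine tendsto_of_tendsto_of_tendsto_of_le_of_le' tendsto_const_nhds hlim ?_ ?_
  · filter_upwards [Filter.eventually_ge_atTop 2] with n hn
    have hpos : (0 : ℝ) < (n - 1).choose (n / 2) := by
      exact_mod_cast Nat.choose_pos (by omega)
    exact (one_le_div hpos).2 (choose_le_logb_ma (by omega) _)
  · filter_upwards [Filter.eventually_ge_atTop 2, hs.eventually_ge_atTop 512] with n hn hs512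
    have hpos : (0 : ℝ) < (n - 1).choose (n / 2) := by
      exact_mod_cast Nat.choose_pos (by omega)
    set s := n.sqrt.sqrt with hs_def
    have h₁ : s ^ 4 ≤ n := by
      calc s ^ 4 = (s * s) * (s * s) := by ring
        _ ≤ n.sqrt * n.sqrt := Nat.mul_le_mul (Nat.sqrt_le _) (Nat.sqrt_le _)
        _ ≤ n := Nat.sqrt_le n
    have h₂ : n ≤ 16 * s ^ 4 := by
      have ha : n.sqrt + 1 ≤ (2 * s) * (2 * s) :=
        (Nat.succ_le_of_lt (Nat.lt_succ_sqrt n.sqrt)).trans (Nat.mul_le_mul (by omega) (by omega))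
      calc n ≤ (n.sqrt + 1) * (n.sqrt + 1) := (Nat.lt_succ_sqrt n).le
        _ ≤ ((2 * s) * (2 * s)) * ((2 * s) * (2 * s)) := Nat.mul_le_mul ha ha
        _ = 16 * s ^ 4 := by ring
    have h := logb_ma_le hs512 (Nat.sqrt_pos.2 (by omega)) (Nat.sqrt_le s) h₁ h₂
    have hs8 : 0 < 1 - 8 / (s : ℝ) := by
      rw [sub_pos, div_lt_one (by exact_mod_cast (by omega : 0 < s))]
      exact_mod_cast (by omega : 8 < s)
    have hN : ((n.choose (n / 2) : ℕ) : ℝ) ≤ 2 * (n - 1).choose (n / 2) := by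
      exact_mod_cast choose_half_le_two_mul (by omega)
    rw [div_le_iff₀ hpos]
    refine (h.trans (mul_le_mul_of_nonneg_right hN (by positivity))).trans (le_of_eq ?_)
    ring
end

section
/- The base-2 logarithm of the number of maximal independent sets of the hypercube graph Q_n is asymptotically 2^{n-2}; precisely, (log₂ mis(Q_n)) / 2^{n-2} tends to 1 as n → ∞. -/
/-- The number of maximal independent sets of a graph `G`. -/
noncomputable def mis {V : Type*} (G : SimpleGraph V) : ℕ :=
  {I : Set V | Maximal (fun s : Set V => s.Pairwise fun a b => ¬ G.Adj a b) I}.ncard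

/-- The hypercube graph `Q_n`: vertices are `0`-`1` strings of length `n`, two vertices being
adjacent iff they differ in exactly one coordinate. -/
def hypercubeGraph (n : ℕ) : SimpleGraph (Fin n → Bool) :=
  SimpleGraph.fromRel (fun x y => (Finset.univ.filter fun i => x i ≠ y i).card = 1)

open Finset

section MaximalIndependent

variable {V : Type*} (G : SimpleGraph V)

open Classical in
/-- The maximal independent sets of the subgraph of `G` induced on `S`. -/
noncomputable def maxIndepIn (S : Finset V) : Finset (Finset V) :=
  S.powerset.filter fun I =>
    (∀ a ∈ I, ∀ b ∈ I, ¬ G.Adj a b) ∧ ∀ v ∈ S, v ∉ I → ∃ u ∈ I, G.Adj v u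

variable {G}

lemma mem_maxIndepIn {S I : Finset V} :
    I ∈ maxIndepIn G S ↔ I ⊆ S ∧ (∀ a ∈ I, ∀ b ∈ I, ¬ G.Adj a b) ∧
      ∀ v ∈ S, v ∉ I → ∃ u ∈ I, G.Adj v u := by
  simp [maxIndepIn]

lemma maxIndepIn_mono {S S' I : Finset V} (hI : I ∈ maxIndepIn G S) (hS : S' ⊆ S)
    (hIS : I ⊆ S') : I ∈ maxIndepIn G S' := by
  rw [mem_maxIndepIn] at hI ⊢
  exact ⟨hIS, hI.2.1, fun v hv => hI.2.2 v (hS hv)⟩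

lemma card_maxIndepIn_filter_notMem_le [DecidableEq V] (S : Finset V) (v : V) :
    #((maxIndepIn G S).filter fun I => v ∉ I) ≤ #(maxIndepIn G (S.erase v)) := by
  refine card_le_card fun I hI => ?_
  rw [mem_filter] at hI
  refine maxIndepIn_mono hI.1 (erase_subset _ _) fun u hu => ?_
  exact mem_erase.2 ⟨fun h => hI.2 (h ▸ hu), (mem_maxIndepIn.1 hI.1).1 hu⟩

lemma card_maxIndepIn_filter_mem_le [DecidableEq V] [DecidableRel G.Adj] (S A : Finset V) (v : V) :
    #((maxIndepIn G S).filter fun I => v ∈ I ∧ ∀ a ∈ A, a ∉ I) ≤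
      #(maxIndepIn G (S \ (insert v (S.filter (G.Adj v)) ∪ A))) := by
  refine card_le_card_of_injOn (fun I => I.erase v) ?_ ?_
  · intro I hI
    rw [mem_coe, mem_filter, mem_maxIndepIn] at hI
    obtain ⟨⟨hS, hind, hmax⟩, hv, hA⟩ := hI
    rw [mem_coe, mem_maxIndepIn]
    refine ⟨fun u hu => ?_, fun a ha b hb => hind a (mem_of_mem_erase ha) b (mem_of_mem_erase hb),
      fun u hu hu' => ?_⟩
    · have h1 := mem_erase.1 hu
      have h2 := hind v hv u h1.2
      have h3 : u ∉ A := fun h => hA u h h1.2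
      simp [hS h1.2, h1.1, h2, h3]
    · simp only [mem_sdiff, mem_union, mem_insert, mem_filter, not_or, not_and] at hu
      obtain ⟨w, hw, hadj⟩ := hmax u hu.1 fun h => hu' (mem_erase.2 ⟨hu.2.1.1, h⟩)
      refine ⟨w, mem_erase.2 ⟨?_, hw⟩, hadj⟩
      rintro rfl
      exact hu.2.1.2 hu.1 hadj.symm
  · intro I hI J hJ h
    rw [mem_coe, mem_filter] at hI hJ
    simp only at h
    rw [← insert_erase hI.2.1, ← insert_erase hJ.2.1, h]

/-- **Hujter–Tuza**: a triangle-free graph on `m` vertices has at most `2 ^ (m / 2)` maximal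
independent sets. -/
theorem card_maxIndepIn_le_of_triangleFree
    (hG : ∀ a b c, G.Adj a b → G.Adj a c → ¬ G.Adj b c) (S : Finset V) :
    (#(maxIndepIn G S) : ℝ) ≤ √2 ^ #S := by
  classical
  induction S using Finset.strongInduction with
  | H S ih =>
  have r2 : √2 ^ 2 = (2 : ℝ) := Real.sq_sqrt (by norm_num)
  have r1 : (1.4 : ℝ) ≤ √2 := Real.le_sqrt_of_sq_le (by norm_num)
  set R := √2 ^ #S with hR
  have R0 : 0 ≤ R := by positivity
  have bound : ∀ k, 0 < k → ∀ X ⊆ S, k ≤ #X → (#(maxIndepIn G (S \ X)) : ℝ) * √2 ^ k ≤ R := by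
    intro k hk X hX hc
    have hss : S \ X ⊂ S := sdiff_ssubset hX (card_pos.1 (by omega))
    calc (#(maxIndepIn G (S \ X)) : ℝ) * √2 ^ k ≤ √2 ^ #(S \ X) * √2 ^ k := by
          gcongr; exact ih _ hss
      _ = √2 ^ (#(S \ X) + k) := (pow_add _ _ _).symm
      _ ≤ R := by
          refine pow_le_pow_right₀ (by linarith) ?_
          have := card_sdiff_add_card_eq_card hX
          omega
  have branch : ∀ k, ∀ v ∈ S, k ≤ #(S.filter (G.Adj v)) + 1 → 0 < k →
      (#((maxIndepIn G S).filter fun I => v ∈ I) : ℝ) * √2 ^ k ≤ R := by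
    intro k v hv hk hk0
    refine le_trans ?_ (bound k hk0 (insert v (S.filter (G.Adj v)) ∪ ∅) ?_ ?_)
    · refine mul_le_mul_of_nonneg_right (Nat.cast_le.2 ?_) (by positivity)
      simpa using card_maxIndepIn_filter_mem_le (G := G) S ∅ v
    · simp [insert_subset_iff, hv]
    · rw [union_empty, card_insert_of_notMem (by simp)]
      exact hk
  have cover : ∀ v ∈ S, ∀ I ∈ maxIndepIn G S, v ∉ I → ∃ u ∈ S.filter (G.Adj v), u ∈ I := by
    intro v hv I hI hvI
    rw [mem_maxIndepIn] at hI
    obtain ⟨u, hu, h⟩ := hI.2.2 v hv hvI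
    exact ⟨u, mem_filter.2 ⟨hI.1 hu, h⟩, hu⟩
  by_cases h3 : ∃ v ∈ S, 3 ≤ #(S.filter (G.Adj v))
  · obtain ⟨v, hv, hd⟩ := h3
    have e1 := branch 4 v hv (by omega) (by norm_num)
    have e2 : (#((maxIndepIn G S).filter fun I => v ∉ I) : ℝ) * √2 ^ 1 ≤ R := by
      refine le_trans ?_ (bound 1 one_pos {v} (by simpa using hv) (by simp))
      refine mul_le_mul_of_nonneg_right (Nat.cast_le.2 ?_) (by positivity)
      simpa [sdiff_singleton_eq_erase] using card_maxIndepIn_filter_notMem_le (G := G) S v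
    have e3 := card_filter_add_card_filter_not (s := maxIndepIn G S) (fun I => v ∈ I)
    have e4 : √2 ^ 4 = (4 : ℝ) := by rw [show (4 : ℕ) = 2 * 2 from rfl, pow_mul, r2]; norm_num
    rw [e4] at e1
    rw [pow_one] at e2
    rw [← e3]
    push_cast
    nlinarith [mul_le_mul_of_nonneg_left r1
      (Nat.cast_nonneg (α := ℝ) #((maxIndepIn G S).filter fun I => v ∉ I))]
  by_cases h0 : ∃ v ∈ S, #(S.filter (G.Adj v)) = 0
  · obtain ⟨v, hv, hd⟩ := h0
    have e1 := branch 1 v hv (by omega) one_pos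
    have e2 : (maxIndepIn G S).filter (fun I => v ∈ I) = maxIndepIn G S := by
      refine filter_true_of_mem fun I hI => ?_
      by_contra hvI
      obtain ⟨u, hu, -⟩ := cover v hv I hI hvI
      rw [card_eq_zero.1 hd] at hu
      simp at hu
    rw [e2, pow_one] at e1
    nlinarith [Nat.cast_nonneg (α := ℝ) #(maxIndepIn G S)]
  by_cases h1 : ∃ v ∈ S, #(S.filter (G.Adj v)) = 1
  · obtain ⟨v, hv, hd⟩ := h1
    obtain ⟨a, ha⟩ := card_eq_one.1 hd
    have haS : a ∈ S.filter (G.Adj v) := by simp [ha]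
    rw [mem_filter] at haS
    have hda : 1 ≤ #(S.filter (G.Adj a)) :=
      card_pos.2 ⟨v, mem_filter.2 ⟨hv, haS.2.symm⟩⟩
    have e1 := branch 2 v hv (by omega) two_pos
    have e2 := branch 2 a haS.1 (by omega) two_pos
    have e3 : maxIndepIn G S ⊆ (maxIndepIn G S).filter (fun I => v ∈ I) ∪
        (maxIndepIn G S).filter (fun I => a ∈ I) := by
      intro I hI
      by_cases hvI : v ∈ I
      · simp [hI, hvI]
      · obtain ⟨u, hu, huI⟩ := cover v hv I hI hvI
        rw [ha, mem_singleton] at hu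
        subst hu
        simp [hI, huI]
    have e4 : (#(maxIndepIn G S) : ℝ) ≤ #((maxIndepIn G S).filter (fun I => v ∈ I)) +
        #((maxIndepIn G S).filter (fun I => a ∈ I)) := by
      exact_mod_cast (card_le_card e3).trans (card_union_le _ _)
    rw [r2] at e1 e2
    linarith
  push Not at h3 h0 h1
  have hdeg : ∀ v ∈ S, #(S.filter (G.Adj v)) = 2 := by
    intro v hv
    have := h3 v hv
    have := h0 v hv
    have := h1 v hv
    omega
  obtain rfl | ⟨v, hv⟩ := S.eq_empty_or_nonempty
  · have : #(maxIndepIn G (∅ : Finset V)) ≤ 1 := by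
      refine card_le_one.2 fun I hI J hJ => ?_
      rw [subset_empty.1 (mem_maxIndepIn.1 hI).1, subset_empty.1 (mem_maxIndepIn.1 hJ).1]
    simpa [hR] using this
  obtain ⟨a, b, hab, hN⟩ := card_eq_two.1 (hdeg v hv)
  have ha : a ∈ S.filter (G.Adj v) := by simp [hN]
  have hb : b ∈ S.filter (G.Adj v) := by simp [hN]
  rw [mem_filter] at ha hb
  have e1 := branch 3 v hv (by rw [hdeg v hv]) three_pos
  have e2 := branch 3 a ha.1 (by rw [hdeg a ha.1]) three_pos
  have e3 : (#((maxIndepIn G S).filter fun I => b ∈ I ∧ a ∉ I) : ℝ) * √2 ^ 4 ≤ R := by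
    refine le_trans ?_ (bound 4 four_pos (insert b (S.filter (G.Adj b)) ∪ {a}) ?_ ?_)
    · refine mul_le_mul_of_nonneg_right (Nat.cast_le.2 ?_) (by positivity)
      simpa using card_maxIndepIn_filter_mem_le (G := G) S {a} b
    · simp [insert_subset_iff, ha.1, hb.1]
    · have hadj : ¬ G.Adj b a := fun h => hG v b a hb.2 ha.2 h
      rw [card_union_of_disjoint (by simp [hab, hadj]), card_insert_of_notMem (by simp),
        hdeg b hb.1, card_singleton]
  have e4 : maxIndepIn G S ⊆ (maxIndepIn G S).filter (fun I => v ∈ I) ∪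
      (maxIndepIn G S).filter (fun I => a ∈ I) ∪
      (maxIndepIn G S).filter (fun I => b ∈ I ∧ a ∉ I) := by
    intro I hI
    by_cases hvI : v ∈ I
    · simp [hI, hvI]
    by_cases haI : a ∈ I
    · simp [hI, haI]
    obtain ⟨u, hu, huI⟩ := cover v hv I hI hvI
    rw [hN, mem_insert, mem_singleton] at hu
    obtain rfl | rfl := hu
    · exact absurd huI haI
    · simp [hI, huI, haI]
  have e5 : (#(maxIndepIn G S) : ℝ) ≤ #((maxIndepIn G S).filter (fun I => v ∈ I)) +
      #((maxIndepIn G S).filter (fun I => a ∈ I)) +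
      #((maxIndepIn G S).filter (fun I => b ∈ I ∧ a ∉ I)) := by
    exact_mod_cast (card_le_card e4).trans
      ((card_union_le _ _).trans (Nat.add_le_add_right (card_union_le _ _) _))
  have p3 : √2 ^ 3 = 2 * √2 := by rw [pow_succ, r2]
  have p4 : √2 ^ 4 = (4 : ℝ) := by rw [show (4 : ℕ) = 2 * 2 from rfl, pow_mul, r2]; norm_num
  rw [p3] at e1 e2
  rw [p4] at e3
  nlinarith [mul_le_mul_of_nonneg_left r1
      (Nat.cast_nonneg (α := ℝ) #((maxIndepIn G S).filter fun I => v ∈ I)),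
    mul_le_mul_of_nonneg_left r1
      (Nat.cast_nonneg (α := ℝ) #((maxIndepIn G S).filter fun I => a ∈ I))]

end MaximalIndependent

section Containers

variable {V : Type*} [Fintype V] {G : SimpleGraph V}

open Classical in
/-- The neighbourhood of a set of vertices. -/
noncomputable def nbhd (G : SimpleGraph V) (T : Finset V) : Finset V :=
  univ.filter fun w => ∃ v ∈ T, G.Adj v w

open Classical in
/-- The container determined by the fingerprint `T` with threshold `φ`. -/
noncomputable def container (G : SimpleGraph V) (φ : ℝ) (T : Finset V) : Finset V :=
  univ.filter fun v => v ∉ nbhd G T ∧ (#(univ.filter (G.Adj v) \ nbhd G T) : ℝ) < φ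

/-- Sapozhenko's greedy choice of a fingerprint of an independent set. -/
lemma exists_fingerprint {φ : ℝ} (hφ : 0 < φ) (I : Finset V)
    (hI : ∀ a ∈ I, ∀ b ∈ I, ¬ G.Adj a b) :
    ∃ T : Finset V, #T * φ ≤ Fintype.card V ∧ I ⊆ container G φ T := by
  classical
  obtain ⟨T, hT, hmax⟩ := exists_max_image
    (I.powerset.filter fun T => #T * φ ≤ #(nbhd G T)) card ⟨∅, by simp⟩
  rw [mem_filter, mem_powerset] at hT
  refine ⟨T, hT.2.trans (by exact_mod_cast card_le_univ _), fun v hv => ?_⟩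
  simp only [container, mem_filter, mem_univ, true_and]
  constructor
  · simp only [nbhd, mem_filter, mem_univ, true_and, not_exists, not_and]
    exact fun u hu => hI u (hT.1 hu) v hv
  · by_contra! hlt
    have hvT : v ∉ T := by
      intro hvT
      have : univ.filter (G.Adj v) \ nbhd G T = ∅ := by
        rw [sdiff_eq_empty_iff_subset]
        intro w hw
        simp only [nbhd, mem_filter, mem_univ, true_and] at hw ⊢
        exact ⟨v, hvT, hw⟩
      rw [this] at hlt
      simp at hlt
      linarith
    have hc : #(insert v T) = #T + 1 := card_insert_of_notMem hvT
    have hN : #(nbhd G T) + #(univ.filter (G.Adj v) \ nbhd G T) ≤ #(nbhd G (insert v T)) := by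
      rw [← card_union_of_disjoint disjoint_sdiff]
      refine card_le_card fun w hw => ?_
      simp only [nbhd, mem_union, mem_sdiff, mem_filter, mem_univ, true_and, mem_insert,
        exists_eq_or_imp] at hw ⊢
      tauto
    have hN' : (#(nbhd G T) : ℝ) + #(univ.filter (G.Adj v) \ nbhd G T) ≤
        #(nbhd G (insert v T)) := by exact_mod_cast hN
    have := hmax (insert v T) (by
      rw [mem_filter, mem_powerset]
      refine ⟨insert_subset hv hT.1, ?_⟩
      rw [hc]
      push_cast
      linarith [hT.2])
    omega

open Classical in
/-- Containers of a `d`-regular graph contain little more than half of the vertices. -/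
lemma card_container_mul_le {φ : ℝ} {d : ℕ} (hd : ∀ v, #(univ.filter (G.Adj v)) = d)
    (T : Finset V) :
    #(container G φ T) * (2 * d - φ) ≤ d * Fintype.card V := by
  set C := container G φ T with hC
  set B := nbhd G T with hB
  have hdis : Disjoint C B := by
    rw [disjoint_left]
    intro v hv
    simp only [hC, container, mem_filter] at hv
    exact hv.2.1
  have hcard : (#C : ℝ) + #B ≤ Fintype.card V := by
    rw [← Nat.cast_add, ← card_union_of_disjoint hdis]
    exact_mod_cast card_le_univ _
  have hdouble := sum_card_bipartiteAbove_eq_sum_card_bipartiteBelow (s := C) (t := B) G.Adj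
  have hup : ∑ b ∈ B, #(bipartiteBelow G.Adj C b) ≤ #B * d := by
    rw [← smul_eq_mul]
    refine sum_le_card_nsmul _ _ _ fun b _ => ?_
    rw [← hd b]
    refine card_le_card fun v hv => ?_
    simp only [mem_bipartiteBelow, mem_filter, mem_univ, true_and] at hv ⊢
    exact hv.2.symm
  have hlow : #C * ((d : ℝ) - φ) ≤ ((∑ a ∈ C, #(bipartiteAbove G.Adj B a) : ℕ) : ℝ) := by
    push_cast
    rw [← nsmul_eq_mul]
    refine card_nsmul_le_sum _ _ _ fun v hv => ?_
    have h1 := (mem_filter.1 hv).2.2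
    have h2 := card_sdiff_add_card_inter (univ.filter (G.Adj v)) B
    have h3 : univ.filter (G.Adj v) ∩ B = bipartiteAbove G.Adj B v := by
      ext w; simp [mem_bipartiteAbove, and_comm]
    rw [h3, hd v] at h2
    have h4 : (d : ℝ) = #(univ.filter (G.Adj v) \ B) + #(bipartiteAbove G.Adj B v) := by
      exact_mod_cast h2.symm
    linarith
  have hup' : ((∑ b ∈ B, #(bipartiteBelow G.Adj C b) : ℕ) : ℝ) ≤ #B * d := by exact_mod_cast hup
  rw [hdouble] at hlow
  nlinarith [Nat.cast_nonneg (α := ℝ) d]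

open Classical in
lemma card_filter_card_mul_le {φ : ℝ} (hφ : 1 ≤ φ) :
    (#(univ.filter fun T : Finset V => #T * φ ≤ Fintype.card V) : ℝ) ≤
      φ ^ (Fintype.card V / φ : ℝ) * (φ⁻¹ + 1) ^ Fintype.card V := by
  have h0 : 0 < φ := by linarith
  rw [← Fintype.sum_pow_mul_eq_add_pow, mul_sum, card_eq_sum_ones, Nat.cast_sum]
  refine (sum_le_sum fun T hT => ?_).trans
    (sum_le_sum_of_subset_of_nonneg (filter_subset _ _) fun T _ _ => by positivity)
  rw [mem_filter] at hT
  rw [one_pow, mul_one, inv_pow, ← Real.rpow_natCast φ, ← div_eq_mul_inv, Nat.cast_one,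
    one_le_div (by positivity)]
  exact Real.rpow_le_rpow_of_exponent_le hφ ((le_div_iff₀ h0).2 hT.2)

lemma mis_le_card_maxIndepIn : mis G ≤ #(maxIndepIn G univ) := by
  classical
  rw [mis, ← Set.ncard_coe_finset]
  refine Set.ncard_le_ncard_of_injOn (fun I => univ.filter (· ∈ I)) ?_ ?_ (finite_toSet _)
  · intro I hI
    have hind : ∀ a ∈ I, ∀ b ∈ I, ¬ G.Adj a b := fun a ha b hb hab => hI.1 ha hb hab.ne hab
    rw [mem_coe, mem_maxIndepIn]
    refine ⟨subset_univ _, by simpa using hind, fun v _ hv => ?_⟩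
    by_contra! hcon
    simp only [mem_filter, mem_univ, true_and] at hv hcon
    refine hv (hI.2 (y := insert v I) ?_ (Set.subset_insert _ _) (Set.mem_insert _ _))
    rintro a (rfl | ha) b (rfl | hb) hab
    · exact absurd rfl hab
    · exact hcon b hb
    · exact fun h => hcon a ha h.symm
    · exact hind a ha b hb
  · intro I _ J _ h
    ext v
    simpa using congrArg (v ∈ ·) h

/-- An upper bound for the number of maximal independent sets of a triangle-free regular graph. -/
theorem mis_le_of_regular_triangleFree {φ : ℝ} {d : ℕ}
    [DecidableRel G.Adj] (hd : ∀ v, #(univ.filter (G.Adj v)) = d)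
    (hG : ∀ a b c, G.Adj a b → G.Adj a c → ¬ G.Adj b c) (hφ : 1 ≤ φ) (hφd : φ < 2 * d) :
    (mis G : ℝ) ≤ φ ^ (Fintype.card V / φ : ℝ) * (φ⁻¹ + 1) ^ Fintype.card V *
      2 ^ (d * Fintype.card V / (2 * d - φ) / 2 : ℝ) := by
  classical
  set F := univ.filter fun T : Finset V => #T * φ ≤ Fintype.card V
  have hcov : maxIndepIn G univ ⊆ F.biUnion fun T => maxIndepIn G (container G φ T) := by
    intro I hI
    obtain ⟨T, hT, hIT⟩ := exists_fingerprint (φ := φ) (by linarith) I (mem_maxIndepIn.1 hI).2.1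
    exact mem_biUnion.2 ⟨T, by simpa [F] using hT, maxIndepIn_mono hI (subset_univ _) hIT⟩
  have hpiece : ∀ T, (#(maxIndepIn G (container G φ T)) : ℝ) ≤
      2 ^ (d * Fintype.card V / (2 * d - φ) / 2 : ℝ) := by
    intro T
    refine (card_maxIndepIn_le_of_triangleFree hG _).trans ?_
    rw [Real.sqrt_eq_rpow, ← Real.rpow_mul_natCast (by norm_num)]
    refine Real.rpow_le_rpow_of_exponent_le (by norm_num) ?_
    have : (#(container G φ T) : ℝ) ≤ d * Fintype.card V / (2 * d - φ) := by
      rw [le_div_iff₀ (by linarith)]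
      refine card_container_mul_le (fun v => ?_) T
      convert hd v
    linarith
  calc (mis G : ℝ) ≤ #(maxIndepIn G univ) := by exact_mod_cast mis_le_card_maxIndepIn
    _ ≤ ∑ T ∈ F, (#(maxIndepIn G (container G φ T)) : ℝ) := by
        exact_mod_cast (card_le_card hcov).trans card_biUnion_le
    _ ≤ #F * 2 ^ (d * Fintype.card V / (2 * d - φ) / 2 : ℝ) := by
        rw [← nsmul_eq_mul]
        exact sum_le_card_nsmul _ _ _ fun T _ => hpiece T
    _ ≤ _ := by
        gcongr
        convert card_filter_card_mul_le (V := V) hφ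

end Containers

/-- An induced matching indexed by `ι` yields `2 ^ |ι|` maximal independent sets. -/
theorem two_pow_le_mis_of_inducedMatching {V ι : Type*} [Finite V] [Fintype ι]
    {G : SimpleGraph V} (f : ι → Bool → V) (hf : ∀ i, G.Adj (f i false) (f i true))
    (hne : ∀ i j s t, i ≠ j → ¬ G.Adj (f i s) (f j t)) :
    2 ^ Fintype.card ι ≤ mis G := by
  classical
  have hex : ∀ A : ι → Bool, ∃ I : Set V, Set.range (fun i => f i (A i)) ≤ I ∧
      Maximal (fun s : Set V => s.Pairwise fun a b => ¬ G.Adj a b) I := by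
    intro A
    refine Finite.exists_le_maximal ?_
    rintro _ ⟨i, rfl⟩ _ ⟨j, rfl⟩ hij
    exact hne i j _ _ fun h => hij (by rw [h])
  choose I hI hmax using hex
  have hinj : Function.Injective I := by
    intro A B hAB
    by_contra hne'
    obtain ⟨i, hi⟩ := Function.ne_iff.1 hne'
    have hA : f i (A i) ∈ I A := hI A ⟨i, rfl⟩
    have hB : f i (B i) ∈ I A := hAB ▸ hI B ⟨i, rfl⟩
    have key : f i false ∈ I A ∧ f i true ∈ I A := by
      cases h1 : A i <;> cases h2 : B i <;> simp_all
    exact (hmax A).1 key.1 key.2 (hf i).ne (hf i)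
  have hrange : Set.range I ⊆
      {I : Set V | Maximal (fun s : Set V => s.Pairwise fun a b => ¬ G.Adj a b) I} := by
    rintro _ ⟨A, rfl⟩
    exact hmax A
  have := Set.ncard_le_ncard hrange (Set.toFinite _)
  rw [← Set.image_univ, Set.ncard_image_of_injective _ hinj, Set.ncard_univ,
    Nat.card_eq_fintype_card, Fintype.card_fun, Fintype.card_bool] at this
  exact this

section Hypercube

variable {n : ℕ}

lemma hypercubeGraph_adj {x y : Fin n → Bool} :
    (hypercubeGraph n).Adj x y ↔ #(univ.filter fun i => x i ≠ y i) = 1 := by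
  rw [hypercubeGraph, SimpleGraph.fromRel_adj]
  constructor
  · rintro ⟨-, h | h⟩
    · exact h
    · simpa only [ne_comm] using h
  · intro h
    refine ⟨?_, Or.inl h⟩
    rintro rfl
    simp at h

lemma hypercubeGraph_adj_iff_update {x y : Fin n → Bool} :
    (hypercubeGraph n).Adj x y ↔ ∃ i, Function.update x i (!x i) = y := by
  rw [hypercubeGraph_adj, card_eq_one]
  refine exists_congr fun i => ?_
  constructor
  · intro h
    funext j
    have hj := Finset.ext_iff.1 h j
    simp only [mem_filter, mem_univ, true_and, mem_singleton] at hj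
    by_cases hji : j = i
    · subst hji
      have := hj.2 rfl
      simp only [Function.update_self]
      cases h1 : x j <;> cases h2 : y j <;> simp_all
    · rw [Function.update_of_ne hji]
      by_contra hne
      exact hji (hj.1 hne)
  · rintro rfl
    ext j
    by_cases hji : j = i
    · subst hji; simp
    · simp [hji]

/-- The parity of a `0`-`1` string. -/
def parity (x : Fin n → Bool) : ZMod 2 := ∑ i, if x i then 1 else 0

lemma parity_ne_of_adj {x y : Fin n → Bool} (h : (hypercubeGraph n).Adj x y) :
    parity x ≠ parity y := by
  obtain ⟨i, rfl⟩ := hypercubeGraph_adj_iff_update.1 h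
  rw [parity, parity, ← add_sum_erase _ _ (mem_univ i),
    ← add_sum_erase univ (fun j => if Function.update x i (!x i) j then (1 : ZMod 2) else 0)
      (mem_univ i)]
  have : ∑ j ∈ univ.erase i, (if Function.update x i (!x i) j then (1 : ZMod 2) else 0) =
      ∑ j ∈ univ.erase i, if x j then 1 else 0 :=
    sum_congr rfl fun j hj => by rw [Function.update_of_ne (ne_of_mem_erase hj)]
  rw [this, Function.update_self]
  intro h
  have := add_right_cancel h
  cases hx : x i <;> simp [hx] at this

lemma hypercubeGraph_triangleFree (a b c : Fin n → Bool) (hab : (hypercubeGraph n).Adj a b)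
    (hac : (hypercubeGraph n).Adj a c) : ¬ (hypercubeGraph n).Adj b c := by
  intro hbc
  have key : ∀ p q r : ZMod 2, p ≠ q → p ≠ r → q = r := by decide
  exact parity_ne_of_adj hbc (key _ _ _ (parity_ne_of_adj hab) (parity_ne_of_adj hac))

lemma card_filter_hypercubeGraph_adj [DecidableRel (hypercubeGraph n).Adj] (x : Fin n → Bool) :
    #(univ.filter ((hypercubeGraph n).Adj x)) = n := by
  have : univ.filter ((hypercubeGraph n).Adj x) =
      univ.image fun i => Function.update x i (!x i) := by
    ext y
    simp [hypercubeGraph_adj_iff_update]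
  rw [this, card_image_of_injective, card_univ, Fintype.card_fin]
  intro i j hij
  by_contra hne
  have := congrFun hij i
  simp [Function.update_of_ne hne] at this

lemma two_pow_two_pow_le_mis_hypercubeGraph (m : ℕ) :
    2 ^ 2 ^ m ≤ mis (hypercubeGraph (m + 2)) := by
  have hcons : ∀ {k : ℕ} (x y : Fin k → Bool) (s t : Bool),
      #(univ.filter fun i => (Fin.cons s x : Fin (k + 1) → Bool) i ≠
        (Fin.cons t y : Fin (k + 1) → Bool) i) =
      (if s ≠ t then 1 else 0) + #(univ.filter fun i => x i ≠ y i) := by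
    intro k x y s t
    simp only [card_filter, Fin.sum_univ_succ, Fin.cons_zero, Fin.cons_succ]
  have := two_pow_le_mis_of_inducedMatching (ι := Fin m → Bool) (G := hypercubeGraph (m + 2))
    (fun x s => Fin.cons s (Fin.cons (decide (parity x = 0)) x)) ?_ ?_
  · simpa using this
  · intro x
    rw [hypercubeGraph_adj, hcons]
    simp
  · intro x y s t hxy h
    rw [hypercubeGraph_adj, hcons, hcons] at h
    have hpos : 0 < #(univ.filter fun i => x i ≠ y i) := by
      obtain ⟨i, hi⟩ := Function.ne_iff.1 hxy
      exact card_pos.2 ⟨i, by simpa using hi⟩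
    have hadj : (hypercubeGraph m).Adj x y := hypercubeGraph_adj.2 (by omega)
    have hpar : decide (parity x = 0) ≠ decide (parity y = 0) := by
      have key : ∀ p q : ZMod 2, p ≠ q → decide (p = 0) ≠ decide (q = 0) := by decide
      exact key _ _ (parity_ne_of_adj hadj)
    rw [if_pos hpar] at h
    omega

lemma logb_mis_hypercubeGraph_le (hn : 2 ≤ n) :
    Real.logb 2 (mis (hypercubeGraph n)) / (2 : ℝ) ^ (n - 2) ≤
      4 * (Real.logb 2 √n / √n + Real.logb 2 ((√n)⁻¹ + 1)) + 2 / (2 - (√n)⁻¹) := by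
  classical
  obtain ⟨m, rfl⟩ := Nat.exists_eq_add_of_le' hn
  have hmis : (0 : ℝ) < mis (hypercubeGraph (m + 2)) := by
    exact_mod_cast (Nat.two_pow_pos _).trans_le (two_pow_two_pow_le_mis_hypercubeGraph m)
  set φ := √((m + 2 : ℕ) : ℝ) with hφ
  have hsq : φ * φ = ((m + 2 : ℕ) : ℝ) := Real.mul_self_sqrt (Nat.cast_nonneg _)
  have h1 : 1 ≤ φ := Real.one_le_sqrt.2 (by push_cast; linarith [Nat.cast_nonneg (α := ℝ) m])
  have h0 : 0 < φ := by linarith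
  have hlt : φ < 2 * ((m + 2 : ℕ) : ℝ) := by rw [← hsq]; nlinarith
  have hbound := mis_le_of_regular_triangleFree (G := hypercubeGraph (m + 2))
    card_filter_hypercubeGraph_adj hypercubeGraph_triangleFree h1 hlt
  have hlog := Real.logb_le_logb_of_le (b := 2) (by norm_num) hmis hbound
  rw [Real.logb_mul (by positivity) (by positivity), Real.logb_mul (by positivity) (by positivity),
    Real.logb_rpow (by norm_num) (by norm_num), Real.logb_rpow_eq_mul_logb_of_pos h0,
    Real.logb_pow] at hlog
  rw [div_le_iff₀ (by positivity)]
  refine hlog.trans (le_of_eq ?_)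
  have hne : 2 * φ - 1 ≠ 0 := by linarith
  have hne' : 2 - φ⁻¹ ≠ 0 := by
    have : φ⁻¹ ≤ 1 := inv_le_one_of_one_le₀ h1
    linarith
  have hfrac : ((m + 2 : ℕ) : ℝ) / (2 * ((m + 2 : ℕ) : ℝ) - φ) = 1 / (2 - φ⁻¹) := by
    rw [div_eq_div_iff (by linarith) hne', ← hsq]
    field_simp
  rw [mul_div_right_comm, hfrac]
  simp only [Fintype.card_fun, Fintype.card_bool, Fintype.card_fin, Nat.add_sub_cancel]
  push_cast
  rw [pow_add]
  ring

end Hypercube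

theorem log_mis_hypercube_asymptotics :
    Filter.Tendsto
      (fun n : ℕ => Real.logb 2 (mis (hypercubeGraph n)) / (2 : ℝ) ^ (n - 2))
      Filter.atTop (nhds 1) := by
  have hsqrt : Filter.Tendsto (fun n : ℕ => √(n : ℝ)) Filter.atTop Filter.atTop :=
    Real.tendsto_sqrt_atTop.comp tendsto_natCast_atTop_atTop
  have hinv := tendsto_inv_atTop_zero.comp hsqrt
  have hlog : Filter.Tendsto (fun n : ℕ => Real.logb 2 √n / √n) Filter.atTop (nhds 0) := by
    have h := ((Real.isLittleO_log_id_atTop.tendsto_div_nhds_zero).comp hsqrt).div_const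
      (Real.log 2)
    rw [zero_div] at h
    refine h.congr fun n => ?_
    simp only [Function.comp, id, Real.logb]
    ring
  have hlog1 : Filter.Tendsto (fun n : ℕ => Real.logb 2 ((√n)⁻¹ + 1)) Filter.atTop (nhds 0) := by
    have h := ((hinv.add_const 1).log (by norm_num)).div_const (Real.log 2)
    simpa [Real.logb] using h
  have hupper : Filter.Tendsto (fun n : ℕ =>
      4 * (Real.logb 2 √n / √n + Real.logb 2 ((√n)⁻¹ + 1)) + 2 / (2 - (√n)⁻¹))
      Filter.atTop (nhds 1) := by
    have h := ((hlog.add hlog1).const_mul 4).add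
      (((hinv.const_sub 2).inv₀ (by norm_num)).const_mul 2)
    simpa [div_eq_mul_inv] using h
  refine tendsto_of_tendsto_of_tendsto_of_le_of_le' tendsto_const_nhds hupper ?_ ?_
  · filter_upwards [Filter.eventually_ge_atTop 2] with n hn
    obtain ⟨m, rfl⟩ := Nat.exists_eq_add_of_le' hn
    have h : ((2 : ℝ) ^ 2 ^ m) ≤ mis (hypercubeGraph (m + 2)) := by
      exact_mod_cast two_pow_two_pow_le_mis_hypercubeGraph m
    have hl := Real.logb_le_logb_of_le (b := 2) (by norm_num) (by positivity) h
    rw [Real.logb_pow, Real.logb_self_eq_one (by norm_num)] at hl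
    rw [one_le_div (by positivity), Nat.add_sub_cancel]
    simpa using hl
  · filter_upwards [Filter.eventually_ge_atTop 2] with n hn
    exact logb_mis_hypercubeGraph_le hn
end

section
/- For every ε > 0 there exists N such that for all n ≥ N and all k with 0 ≤ k ≤ n-1, the base-2 logarithm of the number of maximal independent sets of B_{n,k} satisfies |log₂ mis(B_{n,k}) − binomial(n-1,k)| ≤ ε · binomial(n-1,k). -/
/-- The weight (number of ones) of a `0`-`1` string. -/
def wt {n : ℕ} (x : Fin n → Bool) : ℕ := (Finset.univ.filter fun i => x i = true).card

/-- `B_{n,k}`: the subgraph of `Q_n` induced on the strings of weight `k` or `k+1`. -/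
def middleLayersGraph (n k : ℕ) : SimpleGraph {x : Fin n → Bool | wt x = k ∨ wt x = k + 1} :=
  (hypercubeGraph n).induce {x : Fin n → Bool | wt x = k ∨ wt x = k + 1}


namespace SimpleGraph

variable {V : Type*}

/-- A vertex lies in a maximal independent set iff it has no neighbour there. -/
lemma mem_iff_of_maximal_independent {G : SimpleGraph V} {I : Set V}
    (hI : Maximal (fun s : Set V => s.Pairwise fun a b => ¬ G.Adj a b) I) (v : V) :
    v ∈ I ↔ ∀ u ∈ I, ¬ G.Adj u v := by
  refine ⟨fun hv u hu huv => hI.prop hu hv huv.ne huv, fun h => ?_⟩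
  have hins : (insert v I).Pairwise fun a b => ¬ G.Adj a b :=
    hI.prop.insert fun u hu _ => ⟨fun hvu => h u hu hvu.symm, h u hu⟩
  exact hI.le_of_ge hins (Set.subset_insert v I) (Set.mem_insert v I)

/-- An induced matching indexed by `ι` yields at least `2 ^ |ι|` maximal independent sets. -/
lemma two_pow_card_le_mis {ι : Type*} [Fintype ι] [Finite V] (G : SimpleGraph V) (u v : ι → V)
    (huv : ∀ i j, G.Adj (u i) (v j) ↔ i = j) (huu : ∀ i j, ¬ G.Adj (u i) (u j))
    (hvv : ∀ i j, ¬ G.Adj (v i) (v j)) : 2 ^ Fintype.card ι ≤ mis G := by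
  have hext (S : Set ι) : ∃ J : Set V, u '' S ∪ v '' Sᶜ ⊆ J ∧
      Maximal (fun s : Set V => s.Pairwise fun a b => ¬ G.Adj a b) J := by
    refine Set.Finite.exists_le_maximal (Set.toFinite _) ?_
    rintro _ (⟨i, hi, rfl⟩ | ⟨i, hi, rfl⟩) _ (⟨j, hj, rfl⟩ | ⟨j, hj, rfl⟩) -
    · exact huu i j
    · rw [huv]
      rintro rfl
      exact hj hi
    · rw [G.adj_comm, huv]
      rintro rfl
      exact hi hj
    · exact hvv i j
  choose J hsub hmax using hext
  have hmem (S : Set ι) (i : ι) : u i ∈ J S ↔ i ∈ S := by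
    refine ⟨fun hi => ?_, fun hi => hsub S (Or.inl ⟨i, hi, rfl⟩)⟩
    by_contra hiS
    have hvi : v i ∈ J S := hsub S (Or.inr ⟨i, hiS, rfl⟩)
    exact (mem_iff_of_maximal_independent (hmax S) _).1 hvi _ hi ((huv i i).2 rfl)
  have hinj : Function.Injective J := fun S T hST => by
    ext i
    rw [← hmem S, ← hmem T, hST]
  calc 2 ^ Fintype.card ι = (Set.univ : Set (Set ι)).ncard := by
        rw [Set.ncard_univ, Nat.card_eq_fintype_card, Fintype.card_set]
    _ ≤ mis G := Set.ncard_le_ncard_of_injOn J (fun S _ => hmax S) hinj.injOn (Set.toFinite _)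

/-- A maximal independent set of a bipartite graph is determined by its trace on one side. -/
lemma eq_of_maximal_independent_of_inter_eq {G : SimpleGraph V} {X Y I J : Set V}
    (hG : G.IsBipartiteWith X Y) (hcov : X ∪ Y = Set.univ)
    (hI : Maximal (fun s : Set V => s.Pairwise fun a b => ¬ G.Adj a b) I)
    (hJ : Maximal (fun s : Set V => s.Pairwise fun a b => ¬ G.Adj a b) J)
    (h : I ∩ X = J ∩ X) : I = J := by
  have key {I J : Set V} (hI : Maximal (fun s : Set V => s.Pairwise fun a b => ¬ G.Adj a b) I)
      (hJ : Maximal (fun s : Set V => s.Pairwise fun a b => ¬ G.Adj a b) J)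
      (h : I ∩ X = J ∩ X) : I ⊆ J := by
    intro v hv
    by_cases hvX : v ∈ X
    · exact (h.subset ⟨hv, hvX⟩).1
    have hvY : v ∈ Y := ((Set.ext_iff.1 hcov v).2 trivial).resolve_left hvX
    refine (mem_iff_of_maximal_independent hJ v).2 fun u hu huv => ?_
    have huX : u ∈ X := hG.symm.mem_of_mem_adj hvY huv.symm
    exact (mem_iff_of_maximal_independent hI v).1 hv u (h.symm.subset ⟨hu, huX⟩).1 huv
  exact (key hI hJ h).antisymm (key hJ hI h.symm)

open Finset in
/-- The maximal independent sets of a bipartite graph whose trace on one side lies in `R` number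
at most `2 ^ |R|`. -/
lemma ncard_maximal_independent_le_two_pow [Finite V] {G : SimpleGraph V} {X Y : Set V}
    (hG : G.IsBipartiteWith X Y) (hcov : X ∪ Y = Set.univ) (R : Finset V) :
    {I : Set V | Maximal (fun s : Set V => s.Pairwise fun a b => ¬ G.Adj a b) I ∧
      I ∩ X ⊆ R}.ncard ≤ 2 ^ #R := by
  rw [← Set.ncard_coe_finset R, ← Set.ncard_powerset]
  refine Set.ncard_le_ncard_of_injOn (· ∩ X) (fun I hI => hI.2) ?_ (Set.toFinite _)
  exact fun I hI J hJ h => eq_of_maximal_independent_of_inter_eq hG hcov hI.1 hJ.1 h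

end SimpleGraph

namespace Finset

/-- A greedy choice of few members of `A` whose neighbourhoods cover, for each member of `A`, all
but fewer than `s` of its neighbours. -/
lemma exists_subset_forall_card_sdiff_biUnion_lt {α β : Type*} [DecidableEq α] [DecidableEq β]
    (A : Finset α) (N : α → Finset β) {s : ℝ} (hs : 0 < s) :
    ∃ T ⊆ A, s * #T ≤ #(T.biUnion N) ∧ ∀ v ∈ A, (#(N v \ T.biUnion N) : ℝ) < s := by
  obtain ⟨T, hT, hmax⟩ := exists_max_image
    (A.powerset.filter fun T => s * #T ≤ #(T.biUnion N)) card ⟨∅, by simp⟩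
  simp only [mem_filter, mem_powerset] at hT hmax
  refine ⟨T, hT.1, hT.2, fun v hv => ?_⟩
  by_contra! hlt
  have hvT : v ∉ T := by
    intro hvT
    rw [sdiff_eq_empty_iff_subset.2 (subset_biUnion_of_mem N hvT)] at hlt
    simp only [card_empty, Nat.cast_zero] at hlt
    exact hs.not_ge hlt
  have hcard : #((insert v T).biUnion N) = #(N v \ T.biUnion N) + #(T.biUnion N) := by
    rw [biUnion_insert, card_sdiff_add_card]
  have := hmax (insert v T) ⟨insert_subset hv hT.1, by
    rw [hcard, card_insert_of_notMem hvT]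
    push_cast
    linarith [hT.2]⟩
  rw [card_insert_of_notMem hvT] at this
  omega

/-- A Chernoff-type bound for the number of small subsets. -/
lemma card_filter_card_le_le {α : Type*} (X : Finset α) {x τ : ℝ} (hx : 0 < x) (hx1 : x ≤ 1) :
    (#(X.powerset.filter fun T => (#T : ℝ) ≤ τ) : ℝ) ≤ (1 + x) ^ #X * (1 / x) ^ τ := by
  have hsum : (#(X.powerset.filter fun T => (#T : ℝ) ≤ τ) : ℝ) * x ^ τ ≤ (1 + x) ^ #X := by
    rw [← nsmul_eq_mul, ← sum_const, add_comm, ← sum_pow_mul_eq_add_pow]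
    refine (sum_le_sum fun T hT => ?_).trans
      (sum_le_sum_of_subset_of_nonneg (filter_subset _ _) fun T _ _ => by positivity)
    rw [one_pow, mul_one, ← Real.rpow_natCast]
    exact Real.rpow_le_rpow_of_exponent_ge hx hx1 (mem_filter.1 hT).2
  rw [one_div, Real.inv_rpow hx.le, ← div_eq_mul_inv, le_div_iff₀ (by positivity)]
  exact hsum

end Finset

namespace SimpleGraph

variable {V : Type*}

open Finset in
/-- In a biregular bipartite graph, if each vertex of `R ⊆ X` sends at most `δ a` of its `a` edges
outside `W ⊆ Y`, then `R` is small relative to `W`. -/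
lemma IsBipartiteWith.mul_card_le_mul_card [Fintype V] [DecidableEq V] {G : SimpleGraph V}
    [DecidableRel G.Adj] {a b : ℕ} {δ : ℝ} {R W : Finset V}
    (ha : ∀ v ∈ R, #(G.neighborFinset v) = a) (hb : ∀ v ∈ W, #(G.neighborFinset v) = b)
    (hR : ∀ v ∈ R, (#(G.neighborFinset v \ W) : ℝ) ≤ δ * a) :
    (1 - δ) * a * #R ≤ b * #W := by
  have hcount : ∑ v ∈ R, #(G.neighborFinset v ∩ W) = ∑ w ∈ W, #(G.neighborFinset w ∩ R) := by
    convert sum_card_bipartiteAbove_eq_sum_card_bipartiteBelow (s := R) (t := W) G.Adj using 3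
    all_goals
      ext
      simp [bipartiteAbove, bipartiteBelow, and_comm, G.adj_comm]
  have hle : ∑ w ∈ W, #(G.neighborFinset w ∩ R) ≤ b * #W := by
    rw [mul_comm, ← smul_eq_mul]
    exact sum_le_card_nsmul _ _ _ fun w hw => (card_le_card inter_subset_left).trans (hb w hw).le
  have hge : #R • ((1 - δ) * a) ≤ ∑ v ∈ R, (#(G.neighborFinset v ∩ W) : ℝ) := by
    refine card_nsmul_le_sum _ _ _ fun v hv => ?_
    have h1 : (#(G.neighborFinset v \ W) : ℝ) + #(G.neighborFinset v ∩ W) = a := by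
      exact_mod_cast (card_sdiff_add_card_inter _ _).trans (ha v hv)
    linarith [hR v hv]
  rw [nsmul_eq_mul] at hge
  have : (∑ v ∈ R, (#(G.neighborFinset v ∩ W) : ℝ)) ≤ b * #W := by
    exact_mod_cast hcount.trans_le hle
  linarith

open Finset in
/-- Containers for maximal independent sets in biregular bipartite graphs. -/
lemma IsBipartiteWith.mis_le [Fintype V] [DecidableEq V] {G : SimpleGraph V}
    [DecidableRel G.Adj] {X Y : Finset V} (hG : G.IsBipartiteWith X Y) (hcov : X ∪ Y = univ)
    {a b : ℕ} (ha : 0 < a) (hb : 0 < b) (hX : ∀ v ∈ X, #(G.neighborFinset v) = a)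
    (hY : ∀ v ∈ Y, #(G.neighborFinset v) = b) {δ : ℝ} (hδ : 0 < δ) (hδ1 : δ < 1) :
    mis G ≤ #(X.powerset.filter fun T => (#T : ℝ) ≤ #X / (δ * b)) *
      2 ^ ⌊a * #X / ((1 - δ) * (a + b) : ℝ)⌋₊ := by
  classical
  have haR : (0 : ℝ) < a := by exact_mod_cast ha
  have hbR : (0 : ℝ) < b := by exact_mod_cast hb
  have hcov' : (X ∪ Y : Set V) = Set.univ := by
    exact_mod_cast congrArg ((↑) : Finset V → Set V) hcov
  have hNX {v : V} (hv : v ∈ X) : G.neighborFinset v ⊆ Y :=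
    isBipartiteWith_neighborFinset_subset hG hv
  have hNY {v : V} (hv : v ∈ Y) : G.neighborFinset v ⊆ X :=
    isBipartiteWith_neighborFinset_subset hG.symm hv
  have hedges : (a * #X : ℝ) = b * #Y := by
    refine le_antisymm ?_ ?_
    · simpa using mul_card_le_mul_card (δ := 0) hX hY fun v hv => by
        simp [sdiff_eq_empty_iff_subset.2 (hNX hv)]
    · simpa using mul_card_le_mul_card (δ := 0) hY hX fun v hv => by
        simp [sdiff_eq_empty_iff_subset.2 (hNY hv)]
  set W : Finset V → Finset V := fun T => T.biUnion (fun v => G.neighborFinset v)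
  set RX : Finset V → Finset V := fun T =>
    X.filter fun v => (#(G.neighborFinset v \ W T) : ℝ) < δ * a
  set F : Finset V → Finset (Set V) := fun T => univ.filter fun I =>
    Maximal (fun s : Set V => s.Pairwise fun a b => ¬ G.Adj a b) I ∧
      I ∩ X ⊆ RX T ∧ I ∩ Y ⊆ (Y \ W T : Finset V)
  have hWY {T : Finset V} (hT : T ⊆ X) : W T ⊆ Y := biUnion_subset.2 fun v hv => hNX (hT hv)
  have hcard : mis G =
      #(univ.filter fun I => Maximal (fun s : Set V => s.Pairwise fun a b => ¬ G.Adj a b) I) := by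
    rw [mis, Set.ncard_eq_toFinset_card', Set.toFinset_ofPred]
  rw [hcard]
  refine (card_le_card (t := Finset.biUnion _ F) ?_).trans (card_biUnion_le_card_mul _ F _ ?_)
  · intro I hI
    rw [mem_filter] at hI
    obtain ⟨T, hTI, hTW, hTs⟩ := exists_subset_forall_card_sdiff_biUnion_lt
      (X.filter (· ∈ I)) (fun v => G.neighborFinset v) (mul_pos hδ haR)
    have hTX : T ⊆ X := hTI.trans (filter_subset _ _)
    have hWcard : (#(W T) : ℝ) ≤ #Y := by exact_mod_cast card_le_card (hWY hTX)
    rw [mem_biUnion]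
    refine ⟨T, mem_filter.2 ⟨mem_powerset.2 hTX, ?_⟩, mem_filter.2 ⟨mem_univ _, hI.2, ?_, ?_⟩⟩
    · rw [le_div_iff₀ (by positivity)]
      refine le_of_mul_le_mul_left ?_ haR
      calc (a : ℝ) * (#T * (δ * b)) = b * (δ * a * #T) := by ring
        _ ≤ b * #Y := by gcongr; exact hTW.trans hWcard
        _ = a * #X := hedges.symm
    · rintro v ⟨hvI, hvX⟩
      exact mem_filter.2 ⟨hvX, hTs v (mem_filter.2 ⟨hvX, hvI⟩)⟩
    · rintro v ⟨hvI, hvY⟩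
      refine mem_sdiff.2 ⟨hvY, fun hv => ?_⟩
      obtain ⟨u, huT, huv⟩ := mem_biUnion.1 hv
      exact (mem_iff_of_maximal_independent hI.2 v).1 hvI u (mem_filter.1 (hTI huT)).2
        ((G.mem_neighborFinset u v).1 huv)
  · intro T hT
    have hTX : T ⊆ X := mem_powerset.1 (mem_filter.1 hT).1
    have h1 : #(F T) ≤ 2 ^ #(RX T) := by
      rw [← Set.ncard_coe_finset]
      refine (Set.ncard_le_ncard ?_ (Set.toFinite _)).trans
        (ncard_maximal_independent_le_two_pow hG hcov' (RX T))
      intro I hI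
      have := (mem_filter.1 hI).2
      exact ⟨this.1, this.2.1⟩
    have h2 : #(F T) ≤ 2 ^ #(Y \ W T) := by
      rw [← Set.ncard_coe_finset]
      refine (Set.ncard_le_ncard ?_ (Set.toFinite _)).trans
        (ncard_maximal_independent_le_two_pow hG.symm (by rwa [Set.union_comm]) (Y \ W T))
      intro I hI
      have := (mem_filter.1 hI).2
      exact ⟨this.1, this.2.2⟩
    have h3 : #(F T) ≤ 2 ^ min #(RX T) #(Y \ W T) := by
      rcases min_choice #(RX T) #(Y \ W T) with h | h <;> rw [h] <;> assumption
    refine h3.trans (Nat.pow_le_pow_right two_pos (Nat.le_floor ?_))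
    have hdense : (1 - δ) * a * #(RX T) ≤ b * #(W T) :=
      mul_card_le_mul_card (fun v hv => hX v (mem_filter.1 hv).1) (fun v hv => hY v (hWY hTX hv))
        fun v hv => (mem_filter.1 hv).2.le
    have hsd : (#(Y \ W T) : ℝ) + #(W T) = #Y := by
      exact_mod_cast card_sdiff_add_card_eq_card (hWY hTX)
    rw [le_div_iff₀ (mul_pos (by linarith) (by positivity))]
    set m := min #(RX T) #(Y \ W T)
    have hm1 : (m : ℝ) ≤ #(RX T) := by exact_mod_cast min_le_left _ _
    have hm2 : (m : ℝ) ≤ #(Y \ W T) := by exact_mod_cast min_le_right _ _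
    have hm0 : (0 : ℝ) ≤ m := Nat.cast_nonneg _
    calc (m : ℝ) * ((1 - δ) * (a + b)) ≤ (1 - δ) * a * m + b * m := by
          nlinarith [mul_nonneg (mul_nonneg hδ.le hbR.le) hm0]
      _ ≤ (1 - δ) * a * #(RX T) + b * #(Y \ W T) := by
          have : 0 ≤ 1 - δ := by linarith
          gcongr
      _ ≤ a * #X := by rw [hedges, ← hsd]; linarith

lemma mis_pos [Finite V] (G : SimpleGraph V) : 0 < mis G := by
  obtain ⟨J, -, hJ⟩ := Set.Finite.exists_le_maximal (Set.toFinite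
    {s : Set V | s.Pairwise fun a b => ¬ G.Adj a b}) (a := ∅) (Set.pairwise_empty _)
  exact (Set.ncard_pos (Set.toFinite _)).2 ⟨J, hJ⟩

open Finset in
lemma IsBipartiteWith.logb_mis_le [Fintype V] [DecidableEq V] {G : SimpleGraph V}
    [DecidableRel G.Adj] {X Y : Finset V} (hG : G.IsBipartiteWith X Y) (hcov : X ∪ Y = univ)
    {a b : ℕ} (ha : 0 < a) (hb : 0 < b) (hX : ∀ v ∈ X, #(G.neighborFinset v) = a)
    (hY : ∀ v ∈ Y, #(G.neighborFinset v) = b) {δ : ℝ} (hδ : 0 < δ) (hδ1 : δ < 1)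
    {x : ℝ} (hx : 0 < x) (hx1 : x ≤ 1) :
    Real.logb 2 (mis G) ≤ #X * Real.logb 2 (1 + x) + #X / (δ * b) * Real.logb 2 (1 / x) +
      a * #X / ((1 - δ) * (a + b)) := by
  have haR : (0 : ℝ) < a := by exact_mod_cast ha
  have hmis : (0 : ℝ) < mis G := by exact_mod_cast mis_pos G
  have hle : (mis G : ℝ) ≤ (1 + x) ^ #X * (1 / x) ^ (#X / (δ * b) : ℝ) *
      2 ^ ⌊a * #X / ((1 - δ) * (a + b) : ℝ)⌋₊ := by
    refine (Nat.cast_le.2 (hG.mis_le hcov ha hb hX hY hδ hδ1)).trans ?_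
    push_cast
    gcongr
    exact card_filter_card_le_le X hx hx1
  have hlog := Real.logb_le_logb_of_le one_lt_two hmis hle
  rw [Real.logb_mul (by positivity) (by positivity), Real.logb_mul (by positivity) (by positivity),
    Real.logb_pow, Real.logb_rpow_eq_mul_logb_of_pos (by positivity), Real.logb_pow,
    Real.logb_self_eq_one one_lt_two, mul_one] at hlog
  have hfl : (⌊a * #X / ((1 - δ) * (a + b) : ℝ)⌋₊ : ℝ) ≤ a * #X / ((1 - δ) * (a + b)) :=
    Nat.floor_le (div_nonneg (by positivity) (mul_nonneg (by linarith) (by positivity)))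
  linarith

open Finset in
lemma IsBipartiteWith.logb_mis_le_card [Fintype V] [DecidableEq V] {G : SimpleGraph V}
    {X Y : Finset V} (hG : G.IsBipartiteWith X Y) (hcov : X ∪ Y = univ) :
    Real.logb 2 (mis G) ≤ #X := by
  have hcov' : (X ∪ Y : Set V) = Set.univ := by
    exact_mod_cast congrArg ((↑) : Finset V → Set V) hcov
  have h : mis G ≤ 2 ^ #X := by
    simpa [mis] using ncard_maximal_independent_le_two_pow hG hcov' X
  have hmis : (0 : ℝ) < mis G := by exact_mod_cast mis_pos G
  have := Real.logb_le_logb_of_le one_lt_two hmis (y := 2 ^ #X) (by exact_mod_cast h)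
  rwa [Real.logb_pow, Real.logb_self_eq_one one_lt_two, mul_one] at this

end SimpleGraph

namespace SimpleGraph

open Finset in
/-- In a biregular bipartite graph with degrees `a ≥ b` on `X` and `Y`, the logarithm of the number
of maximal independent sets is at most about `a |X| / (a + b - 1)` when `a + b` is large. -/
lemma exists_forall_logb_mis_le {ε : ℝ} (hε : 0 < ε) : ∃ N : ℕ, ∀ {V : Type*} [Fintype V]
    [DecidableEq V] {G : SimpleGraph V} [DecidableRel G.Adj] {X Y : Finset V} {a b : ℕ},
    G.IsBipartiteWith X Y → X ∪ Y = univ → 0 < b → b ≤ a → N ≤ a + b →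
    (∀ v ∈ X, #(G.neighborFinset v) = a) → (∀ v ∈ Y, #(G.neighborFinset v) = b) →
    Real.logb 2 (mis G) ≤ (1 + ε) * (a * #X / (a + b - 1)) := by
  set δ : ℝ := ε / (3 + ε) with hδ_def
  have hδ : 0 < δ := by positivity
  have hδ' : 1 - δ = 3 / (3 + ε) := by rw [hδ_def]; field_simp; ring
  have hδ1 : δ < 1 := by
    have : 0 < 1 - δ := by rw [hδ']; positivity
    linarith
  set x : ℝ := min 1 (2 ^ (ε / 6) - 1)
  have hx : 0 < x := lt_min one_pos
    (sub_pos.2 (Real.one_lt_rpow one_lt_two (by positivity)))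
  have hx1 : x ≤ 1 := min_le_left _ _
  have hlogx : Real.logb 2 (1 + x) ≤ ε / 6 := by
    rw [Real.logb_le_iff_le_rpow one_lt_two (by positivity)]
    linarith [min_le_right (1 : ℝ) (2 ^ (ε / 6) - 1)]
  set L : ℝ := Real.logb 2 (1 / x)
  obtain ⟨B, hB⟩ := exists_nat_ge (6 * L / (δ * ε))
  obtain ⟨N, hN⟩ := exists_nat_ge (2 * B / ε)
  refine ⟨N, fun {V} _ _ {G} _ {X Y a b} hG hcov hb hba hNab hX hY => ?_⟩
  have ha : 0 < a := hb.trans_le hba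
  have haR : (1 : ℝ) ≤ a := by exact_mod_cast ha
  have hbR : (1 : ℝ) ≤ b := by exact_mod_cast hb
  have hbaR : (b : ℝ) ≤ a := by exact_mod_cast hba
  have hNR : (N : ℝ) ≤ a + b := by exact_mod_cast hNab
  have hden : (0 : ℝ) < a + b - 1 := by linarith
  set M : ℝ := (#X : ℝ)
  have hM0 : 0 ≤ M := Nat.cast_nonneg _
  set C : ℝ := a * M / (a + b - 1) with hC
  have hC0 : 0 ≤ C := by positivity
  have hMC : a * M = C * (a + b - 1) := by rw [hC]; field_simp
  rcases le_total B b with hBb | hbB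
  · have hBbR : (B : ℝ) ≤ b := by exact_mod_cast hBb
    have hM2 : M ≤ 2 * C := by
      refine le_of_mul_le_mul_left ?_ (by linarith : (0 : ℝ) < a)
      rw [hMC]
      nlinarith
    have hlogL : 1 / (δ * b) * L ≤ ε / 6 := by
      have := hB.trans hBbR
      rw [div_le_iff₀ (by positivity)] at this
      rw [one_div_mul_eq_div, div_le_iff₀ (by positivity)]
      linarith
    have hlast : a * M / ((1 - δ) * (a + b)) ≤ (1 + ε / 3) * C := by
      have : a * M / ((1 - δ) * (a + b)) = (1 + ε / 3) * (a * M / (a + b)) := by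
        rw [hδ']; field_simp
      rw [this, hC]
      exact mul_le_mul_of_nonneg_left
        (div_le_div_of_nonneg_left (mul_nonneg (by linarith) hM0) hden (by linarith)) (by positivity)
    calc Real.logb 2 (mis G) ≤ M * Real.logb 2 (1 + x) + M / (δ * b) * L +
          a * M / ((1 - δ) * (a + b)) := hG.logb_mis_le hcov ha hb hX hY hδ hδ1 hx hx1
      _ = M * (Real.logb 2 (1 + x) + 1 / (δ * b) * L) + a * M / ((1 - δ) * (a + b)) := by ring
      _ ≤ M * (ε / 6 + ε / 6) + (1 + ε / 3) * C :=
        add_le_add (mul_le_mul_of_nonneg_left (add_le_add hlogx hlogL) hM0) hlast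
      _ ≤ 2 * C * (ε / 6 + ε / 6) + (1 + ε / 3) * C :=
        add_le_add_left (mul_le_mul_of_nonneg_right hM2 (by positivity)) _
      _ = (1 + ε) * C := by ring
  · have hbBR : (b : ℝ) ≤ B := by exact_mod_cast hbB
    refine (hG.logb_mis_le_card hcov).trans ?_
    refine le_of_mul_le_mul_left ?_ (by linarith : (0 : ℝ) < a)
    have h2 : B ≤ ε * a := by
      rw [div_le_iff₀ hε] at hN
      nlinarith
    calc a * M = C * (a + b - 1) := hMC
      _ ≤ C * (a + ε * a) := mul_le_mul_of_nonneg_left (by linarith) hC0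
      _ = a * ((1 + ε) * C) := by ring

end SimpleGraph

section MiddleLayers

open Finset

lemma card_filter_wt_eq (n j : ℕ) : #{x : Fin n → Bool | wt x = j} = n.choose j := by
  have h : #(powersetCard j (univ : Finset (Fin n))) = n.choose j := by simp
  rw [← h]
  refine card_bij' (fun x _ => univ.filter fun i => x i = true) (fun s _ i => decide (i ∈ s))
    ?_ ?_ ?_ ?_
  · intro x hx
    exact mem_powersetCard.2 ⟨subset_univ _, (mem_filter.1 hx).2⟩
  · intro s hs
    exact mem_filter.2 ⟨mem_univ _, by simpa [wt] using hs⟩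
  · intro x _
    ext i
    simp
  · intro s _
    ext i
    simp

lemma wt_update_not_add {n : ℕ} (x : Fin n → Bool) (i : Fin n) :
    wt (Function.update x i (!x i)) + (x i).toNat = wt x + (!x i).toNat := by
  have h (y : Fin n → Bool) : wt y = ∑ j, (y j).toNat := by
    simp only [wt, card_filter]
    exact sum_congr rfl fun j _ => by cases y j <;> rfl
  rw [h, h, ← add_sum_erase _ _ (mem_univ i), ← add_sum_erase _ (fun j => (x j).toNat) (mem_univ i)]
  rw [sum_congr rfl fun j hj => by rw [Function.update_of_ne (ne_of_mem_erase hj)]]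
  simp only [Function.update_self]
  ring

lemma hypercubeGraph_adj_iff {n : ℕ} {x y : Fin n → Bool} :
    (hypercubeGraph n).Adj x y ↔ ∃ i, y = Function.update x i (!x i) := by
  have hsymm : #{i | y i ≠ x i} = #{i | x i ≠ y i} := by simp only [ne_comm]
  rw [hypercubeGraph, SimpleGraph.fromRel_adj, hsymm, or_self, card_eq_one]
  constructor
  · rintro ⟨-, i, hi⟩
    refine ⟨i, funext fun j => ?_⟩
    have hj := Finset.ext_iff.1 hi j
    simp only [mem_filter, mem_univ, true_and, mem_singleton] at hj
    by_cases hji : j = i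
    · subst hji
      rw [Function.update_self]
      exact Bool.eq_not.2 (hj.2 rfl).symm
    · rw [Function.update_of_ne hji]
      exact (not_not.1 (mt hj.1 hji)).symm
  · rintro ⟨i, rfl⟩
    have hi : univ.filter (fun j => x j ≠ Function.update x i (!x i) j) = {i} := by
      ext j
      by_cases hji : j = i
      · subst hji
        simp
      · simp [hji]
    refine ⟨fun h => ?_, i, hi⟩
    simpa using congrFun h i

/-- The vertices of weight `j` in `B_{n,k}`. -/
def middleLayer (n k j : ℕ) : Finset {x : Fin n → Bool | wt x = k ∨ wt x = k + 1} :=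
  univ.filter fun x => wt x.1 = j

lemma card_middleLayer {n k j : ℕ} (hj : j = k ∨ j = k + 1) :
    #(middleLayer n k j) = n.choose j := by
  rw [← card_filter_wt_eq]
  refine card_bij (fun x _ => x.1) ?_ (fun x _ y _ h => Subtype.ext h) ?_
  · intro x hx
    simpa [middleLayer] using hx
  · intro x hx
    have hx' : wt x = j := by simpa using hx
    exact ⟨⟨x, by simpa [hx'] using hj⟩, by simpa [middleLayer] using hx', rfl⟩

lemma middleLayer_union (n k : ℕ) : middleLayer n k k ∪ middleLayer n k (k + 1) = univ := by
  refine Finset.eq_univ_of_forall fun x => ?_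
  simp only [middleLayer, mem_union, mem_filter, mem_univ, true_and]
  exact x.2

lemma middleLayersGraph_adj_iff {n k : ℕ}
    {x y : {x : Fin n → Bool | wt x = k ∨ wt x = k + 1}} :
    (middleLayersGraph n k).Adj x y ↔ ∃ i, y.1 = Function.update x.1 i (!x.1 i) :=
  hypercubeGraph_adj_iff

lemma isBipartiteWith_middleLayer (n k : ℕ) :
    (middleLayersGraph n k).IsBipartiteWith (middleLayer n k k) (middleLayer n k (k + 1)) where
  disjoint := by
    rw [Finset.disjoint_coe, Finset.disjoint_left]
    intro x hx hx'
    simp only [middleLayer, mem_filter] at hx hx'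
    omega
  mem_of_adj := by
    intro x y hxy
    obtain ⟨i, hi⟩ := middleLayersGraph_adj_iff.1 hxy
    have hwt := wt_update_not_add x.1 i
    rw [← hi] at hwt
    have hx := x.2
    have hy := y.2
    simp only [Set.mem_ofPred_eq] at hx hy
    simp only [middleLayer, coe_filter, mem_univ, true_and, Set.mem_ofPred_eq]
    cases h : x.1 i <;> simp only [h, Bool.toNat_true, Bool.toNat_false, Bool.not_true,
      Bool.not_false] at hwt <;> omega

lemma card_neighborFinset_eq_card_filter {n k : ℕ} [DecidableRel (middleLayersGraph n k).Adj]
    (x : {x : Fin n → Bool | wt x = k ∨ wt x = k + 1}) {c : Bool}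
    (hc : wt x.1 = k + c.toNat) :
    #((middleLayersGraph n k).neighborFinset x) = #{i | x.1 i = c} := by
  symm
  have hmem (i : Fin n) : (wt (Function.update x.1 i (!x.1 i)) = k ∨
      wt (Function.update x.1 i (!x.1 i)) = k + 1) ↔ x.1 i = c := by
    have hwt := wt_update_not_add x.1 i
    cases c <;> cases h : x.1 i <;> simp [h] at hwt hc ⊢ <;> omega
  refine card_bij (fun i hi => ⟨Function.update x.1 i (!x.1 i),
    (hmem i).2 (mem_filter.1 hi).2⟩) ?_ ?_ ?_
  · intro i hi
    rw [SimpleGraph.mem_neighborFinset, middleLayersGraph_adj_iff]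
    exact ⟨i, rfl⟩
  · intro i hi j hj hij
    by_contra hne
    have := congrFun (congrArg Subtype.val hij) i
    simp [Function.update_of_ne hne] at this
  · intro y hy
    rw [SimpleGraph.mem_neighborFinset, middleLayersGraph_adj_iff] at hy
    obtain ⟨i, hi⟩ := hy
    have hy := y.2
    rw [Set.mem_ofPred_eq, hi, hmem] at hy
    exact ⟨i, by simpa using hy, Subtype.ext hi.symm⟩

lemma card_neighborFinset_of_mem_lower {n k : ℕ} [DecidableRel (middleLayersGraph n k).Adj] :
    ∀ x ∈ middleLayer n k k, #((middleLayersGraph n k).neighborFinset x) = n - k := by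
  intro x hx
  have hx' : wt x.1 = k := by simpa [middleLayer] using hx
  rw [card_neighborFinset_eq_card_filter x (c := false) (by simpa using hx')]
  have h := card_filter_add_card_filter_not (s := univ) (fun i => x.1 i = true)
  simp only [Bool.not_eq_true, card_univ, Fintype.card_fin] at h
  rw [wt] at hx'
  omega

lemma card_neighborFinset_of_mem_upper {n k : ℕ} [DecidableRel (middleLayersGraph n k).Adj] :
    ∀ x ∈ middleLayer n k (k + 1), #((middleLayersGraph n k).neighborFinset x) = k + 1 := by
  intro x hx
  have hx' : wt x.1 = k + 1 := by simpa [middleLayer] using hx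
  rw [card_neighborFinset_eq_card_filter x (c := true) (by simpa using hx')]
  exact hx'

lemma wt_cons {m : ℕ} (c : Bool) (z : Fin m → Bool) :
    wt (Fin.cons c z : Fin (m + 1) → Bool) = wt z + c.toNat := by
  have h {l : ℕ} (y : Fin l → Bool) : wt y = ∑ j, (y j).toNat := by
    simp only [wt, card_filter]
    exact sum_congr rfl fun j _ => by cases y j <;> rfl
  rw [h, h, Fin.sum_univ_succ]
  simp [add_comm]

/-- The edges of `B_{m+1,k}` in one direction form an induced matching. -/
lemma two_pow_choose_le_mis (m k : ℕ) : 2 ^ m.choose k ≤ mis (middleLayersGraph (m + 1) k) := by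
  have hcard : Fintype.card {z : Fin m → Bool // wt z = k} = m.choose k := by
    rw [Fintype.card_subtype, card_filter_wt_eq]
  rw [← hcard]
  have hbip := isBipartiteWith_middleLayer (m + 1) k
  have hlow (z : {z : Fin m → Bool // wt z = k}) :
      wt (Fin.cons false z.1 : Fin (m + 1) → Bool) = k := by simp [wt_cons, z.2]
  have hupp (z : {z : Fin m → Bool // wt z = k}) :
      wt (Fin.cons true z.1 : Fin (m + 1) → Bool) = k + 1 := by simp [wt_cons, z.2]
  refine SimpleGraph.two_pow_card_le_mis _ (fun z => ⟨Fin.cons false z.1, Or.inl (hlow z)⟩)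
    (fun z => ⟨Fin.cons true z.1, Or.inr (hupp z)⟩) ?_ ?_ ?_
  · intro z w
    rw [middleLayersGraph_adj_iff]
    constructor
    · rintro ⟨i, hi⟩
      dsimp only at hi
      cases i using Fin.cases with
      | zero =>
        refine Subtype.ext (funext fun j => ?_)
        simpa using (congrFun hi j.succ).symm
      | succ i =>
        have := congrFun hi 0
        simp [Function.update_of_ne (Fin.succ_ne_zero i).symm] at this
    · rintro rfl
      refine ⟨0, funext fun j => ?_⟩
      cases j using Fin.cases <;> simp
  · intro z w hzw
    have hw := hbip.mem_of_mem_adj (by simpa [middleLayer] using hlow z) hzw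
    have : wt (Fin.cons false w.1 : Fin (m + 1) → Bool) = k + 1 := by
      simpa [middleLayer] using hw
    have := hlow w
    omega
  · intro z w hzw
    have hw := hbip.symm.mem_of_mem_adj (by simpa [middleLayer] using hupp z) hzw
    have : wt (Fin.cons true w.1 : Fin (m + 1) → Bool) = k := by
      simpa [middleLayer] using hw
    have := hupp w
    omega

end MiddleLayers

theorem log_mis_middleLayers_asymptotics :
    ∀ ε : ℝ, 0 < ε → ∃ N : ℕ, ∀ n : ℕ, N ≤ n → ∀ k : ℕ, k ≤ n - 1 →
      |Real.logb 2 (mis (middleLayersGraph n k)) - ((n - 1).choose k : ℝ)| ≤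
        ε * ((n - 1).choose k : ℝ) := by
  classical
  intro ε hε
  obtain ⟨N, hN⟩ := SimpleGraph.exists_forall_logb_mis_le hε
  refine ⟨N + 1, fun n hn k hk => ?_⟩
  obtain ⟨m, rfl⟩ : ∃ m, n = m + 1 := ⟨n - 1, by omega⟩
  rw [Nat.add_sub_cancel] at hk ⊢
  have hm : (0 : ℝ) < m + 1 := by positivity
  have hlower : (m.choose k : ℝ) ≤ Real.logb 2 (mis (middleLayersGraph (m + 1) k)) := by
    rw [Real.le_logb_iff_rpow_le one_lt_two (by exact_mod_cast SimpleGraph.mis_pos _),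
      Real.rpow_natCast]
    exact_mod_cast two_pow_choose_le_mis m k
  have hupper : Real.logb 2 (mis (middleLayersGraph (m + 1) k)) ≤ (1 + ε) * m.choose k := by
    have hbip := isBipartiteWith_middleLayer (m + 1) k
    have hsub : ((m + 1 - k : ℕ) : ℝ) = m + 1 - k := by
      rw [Nat.cast_sub (by omega)]
      push_cast
      ring
    rcases le_total (k + 1) (m + 1 - k) with h | h
    · refine (hN hbip (middleLayer_union _ _) k.succ_pos h (by omega)
        card_neighborFinset_of_mem_lower card_neighborFinset_of_mem_upper).trans_eq ?_
      have hid : (m.choose k : ℝ) * (m + 1) = (m + 1).choose k * ((m + 1 - k : ℕ) : ℝ) := by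
        exact_mod_cast Nat.choose_mul_succ_eq m k
      rw [card_middleLayer (Or.inl rfl), mul_comm ((m + 1 - k : ℕ) : ℝ), ← hid, hsub]
      push_cast
      rw [show (m + 1 - k + (k + 1) - 1 : ℝ) = m + 1 by ring]
      field_simp
    · refine (hN hbip.symm (by rw [Finset.union_comm, middleLayer_union]) (by omega) h (by omega)
        card_neighborFinset_of_mem_upper card_neighborFinset_of_mem_lower).trans_eq ?_
      have hid : ((m : ℝ) + 1) * m.choose k = (m + 1).choose (k + 1) * ((k + 1 : ℕ) : ℝ) := by
        exact_mod_cast Nat.add_one_mul_choose_eq m k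
      rw [card_middleLayer (Or.inr rfl), mul_comm ((k + 1 : ℕ) : ℝ), ← hid, hsub]
      push_cast
      rw [show (k + 1 + (m + 1 - k) - 1 : ℝ) = m + 1 by ring]
      field_simp
  rw [abs_le]
  constructor <;> nlinarith [Nat.cast_nonneg (α := ℝ) (m.choose k)]
end

section
/- For every ε > 0 there exists D such that the following holds: if G is a bipartite graph on n vertices with bipartition A ∪ B in which every vertex of A has degree r, every vertex of B has degree s, and max{r,s} ≥ D, then log₂ mis(G) ≤ (1+ε) · r·s·n / (r+s)². -/
namespace SimpleGraph

variable {V : Type*} {G : SimpleGraph V}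

theorem mem_iff_of_maximal_isIndepSet {I : Set V} (hI : Maximal G.IsIndepSet I) (v : V) :
    v ∈ I ↔ ∀ u ∈ I, ¬ G.Adj v u := by
  refine ⟨fun hv u hu huv => hI.prop hv hu huv.ne huv, fun h => ?_⟩
  refine hI.le_of_ge (y := insert v I) ?_ (Set.subset_insert v I) (Set.mem_insert v I)
  exact hI.prop.insert fun u hu _ => ⟨h u hu, fun huv => h u hu huv.symm⟩

/-- A maximal independent set of a bipartite graph is determined by its trace on one side. -/
theorem eq_of_maximal_isIndepSet_of_inter_eq {A B I J : Set V} (hAB : G.IsBipartiteWith A B)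
    (hcover : ∀ v, v ∈ A ∨ v ∈ B) (hI : Maximal G.IsIndepSet I) (hJ : Maximal G.IsIndepSet J)
    (h : ∀ v ∈ A, v ∈ I ↔ v ∈ J) : I = J := by
  ext v
  rcases hcover v with hv | hv
  · exact h v hv
  · rw [mem_iff_of_maximal_isIndepSet hI, mem_iff_of_maximal_isIndepSet hJ]
    refine forall_congr' fun u => ?_
    by_cases huv : G.Adj v u
    · simp [huv, h u (hAB.symm.mem_of_mem_adj hv huv)]
    · simp [huv]

theorem card_le_two_pow_of_trace_subset [DecidableEq V] {A B C : Finset V}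
    (hAB : G.IsBipartiteWith (A : Set V) B) (hcover : ∀ v, v ∈ A ∨ v ∈ B)
    (F : Finset (Set V)) (hF : ∀ I ∈ F, Maximal G.IsIndepSet I)
    (hC : ∀ I ∈ F, ∀ v ∈ A, v ∈ I → v ∈ C) : F.card ≤ 2 ^ C.card := by
  classical
  rw [← Finset.card_powerset]
  refine Finset.card_le_card_of_injOn (fun I => A.filter (· ∈ I)) ?_ ?_
  · intro I hI
    simp only [Finset.coe_powerset, Set.mem_preimage, Set.mem_powerset_iff, Finset.coe_subset]
    intro v hv
    rw [Finset.mem_filter] at hv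
    exact hC I hI v hv.1 hv.2
  · intro I hI J hJ h
    refine eq_of_maximal_isIndepSet_of_inter_eq hAB hcover (hF I hI) (hF J hJ) fun v hv => ?_
    have := Finset.ext_iff.1 h v
    have hvA : v ∈ A := hv
    simpa [hvA] using this

section Container

variable [Fintype V] [DecidableEq V] [DecidableRel G.Adj]

/-- The vertices of `B` with no neighbour in `S`. -/
def unseen (G : SimpleGraph V) [DecidableRel G.Adj] (B S : Finset V) : Finset V :=
  B \ S.biUnion fun v => G.neighborFinset v

/-- Every independent set has a small fingerprint `S` in `A`, such that each vertex of `A` in the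
set has few neighbours outside the neighbourhood of `S`. -/
theorem exists_fingerprint {A B : Finset V} (hAB : G.IsBipartiteWith (A : Set V) B) {I : Set V}
    (hI : G.IsIndepSet I) {t : ℕ} (ht : 0 < t) :
    ∃ S ⊆ A, S.card * t ≤ B.card ∧ (∀ v ∈ B, v ∈ I → v ∈ G.unseen B S) ∧
      ∀ v ∈ A, v ∈ I → (G.neighborFinset v ∩ G.unseen B S).card < t := by
  classical
  let F : Finset (Finset V) := A.powerset.filter fun S =>
    (∀ v ∈ S, v ∈ I) ∧ S.card * t ≤ (S.biUnion fun v => G.neighborFinset v).card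
  have hne : F.Nonempty := ⟨∅, by simp [F]⟩
  obtain ⟨S, hS, hmax⟩ := F.exists_max_image Finset.card hne
  simp only [F, Finset.mem_filter, Finset.mem_powerset] at hS hmax
  obtain ⟨hSA, hSI, hcard⟩ := hS
  refine ⟨S, hSA, hcard.trans (Finset.card_le_card ?_), ?_, ?_⟩
  · intro v hv
    obtain ⟨u, hu, huv⟩ := Finset.mem_biUnion.1 hv
    exact hAB.mem_of_mem_adj (hSA hu) ((G.mem_neighborFinset u v).1 huv)
  · intro v hv hvI
    refine Finset.mem_sdiff.2 ⟨hv, fun h => ?_⟩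
    obtain ⟨u, hu, huv⟩ := Finset.mem_biUnion.1 h
    have huv := (G.mem_neighborFinset u v).1 huv
    exact hI (hSI u hu) hvI huv.ne huv
  · intro v hv hvI
    by_contra! hlt
    have hsub : G.neighborFinset v ∩ G.unseen B S ⊆
        G.neighborFinset v \ S.biUnion fun v => G.neighborFinset v := by
      intro u hu
      simp only [unseen, Finset.mem_inter, Finset.mem_sdiff] at hu ⊢
      exact ⟨hu.1, hu.2.2⟩
    have hle := hlt.trans (Finset.card_le_card hsub)
    have hvS : v ∉ S := by
      intro hvS
      have hsubS := Finset.subset_biUnion_of_mem (fun v => G.neighborFinset v) hvS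
      rw [Finset.sdiff_eq_empty_iff_subset.2 hsubS, Finset.card_empty] at hle
      omega
    have := hmax (insert v S) ⟨Finset.insert_subset hv hSA, by simpa [hvI] using hSI, by
      rw [Finset.biUnion_insert, Finset.card_insert_of_notMem hvS,
        ← Finset.card_sdiff_add_card, add_mul]
      omega⟩
    rw [Finset.card_insert_of_notMem hvS] at this
    omega

theorem card_mul_add_card_mul_le {A B C : Finset V} (hAB : G.IsBipartiteWith (A : Set V) B)
    {r s : ℕ} (hA : ∀ v ∈ A, G.degree v = r) (hB : ∀ v ∈ B, G.degree v = s) (hC : C ⊆ B) (t : ℕ) :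
    (A.filter fun v => (G.neighborFinset v ∩ C).card < t).card * r + C.card * s ≤
      A.card * (r + t) := by
  have hcount : C.card * s = ∑ v ∈ A, (G.neighborFinset v ∩ C).card := by
    have h := Finset.sum_card_bipartiteAbove_eq_sum_card_bipartiteBelow (s := A) (t := C) G.Adj
    have h1 : ∀ v ∈ A, (Finset.bipartiteAbove G.Adj C v) = G.neighborFinset v ∩ C := by
      intro v _
      ext u
      simp [Finset.bipartiteAbove, and_comm]
    have h2 : ∀ u ∈ C, (Finset.bipartiteBelow G.Adj A u).card = s := by
      intro u hu
      rw [← hB u (hC hu), ← G.card_neighborFinset_eq_degree]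
      congr 1
      ext v
      simp only [Finset.bipartiteBelow, Finset.mem_filter, mem_neighborFinset]
      exact ⟨fun h => h.2.symm, fun h => ⟨hAB.symm.mem_of_mem_adj (hC hu) h, h.symm⟩⟩
    rw [Finset.sum_congr rfl h2, Finset.sum_const, smul_eq_mul] at h
    rw [← h]
    exact Finset.sum_congr rfl fun v hv => by rw [h1 v hv]
  rw [hcount, Finset.card_filter, Finset.sum_mul, ← Finset.sum_add_distrib, Finset.card_eq_sum_ones,
    Finset.sum_mul]
  refine Finset.sum_le_sum fun v hv => ?_
  have hle : (G.neighborFinset v ∩ C).card ≤ r := by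
    rw [← hA v hv, ← G.card_neighborFinset_eq_degree]
    exact Finset.card_le_card Finset.inter_subset_left
  split_ifs <;> omega

end Container

end SimpleGraph

open SimpleGraph in
theorem mis_le_two_pow_card {V : Type*} [Fintype V] [DecidableEq V] {G : SimpleGraph V}
    {A B : Finset V} (hAB : G.IsBipartiteWith (A : Set V) B) (hcover : ∀ v, v ∈ A ∨ v ∈ B) :
    mis G ≤ 2 ^ A.card := by
  classical
  change {I : Set V | Maximal G.IsIndepSet I}.ncard ≤ _
  rw [Set.ncard_eq_toFinset_card']
  exact card_le_two_pow_of_trace_subset hAB hcover _ (fun I hI => by simpa using hI)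
    fun _ _ _ hv _ => hv

open SimpleGraph in
/-- Maximal independent sets are counted by first choosing a fingerprint and then the trace on the
smaller side of the remaining graph. -/
theorem mis_le_two_pow_mul_card {V : Type*} [Fintype V] [DecidableEq V] {G : SimpleGraph V}
    [DecidableRel G.Adj] {A B : Finset V} (hAB : G.IsBipartiteWith (A : Set V) B)
    (hcover : ∀ v, v ∈ A ∨ v ∈ B) {r s : ℕ} (hA : ∀ v ∈ A, G.degree v = r)
    (hB : ∀ v ∈ B, G.degree v = s) (hr : 0 < r) {t : ℕ} (ht : 0 < t) :
    mis G ≤ 2 ^ (A.card * (r + t) / (r + s)) *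
      (A.powerset.filter fun S => S.card * t ≤ B.card).card := by
  classical
  change {I : Set V | Maximal G.IsIndepSet I}.ncard ≤ _
  rw [Set.ncard_eq_toFinset_card']
  have hmem : ∀ I ∈ {I : Set V | Maximal G.IsIndepSet I}.toFinset, Maximal G.IsIndepSet I :=
    fun I hI => by simpa using hI
  have key : ∀ I : Set V, ∃ S : Finset V, Maximal G.IsIndepSet I →
      S ⊆ A ∧ S.card * t ≤ B.card ∧ (∀ v ∈ B, v ∈ I → v ∈ G.unseen B S) ∧
      ∀ v ∈ A, v ∈ I → (G.neighborFinset v ∩ G.unseen B S).card < t := by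
    intro I
    by_cases hI : Maximal G.IsIndepSet I
    · obtain ⟨S, hS⟩ := exists_fingerprint hAB hI.prop ht
      exact ⟨S, fun _ => hS⟩
    · exact ⟨∅, fun h => absurd h hI⟩
  choose f hf using key
  refine Finset.card_le_mul_card_image_of_maps_to (f := f) ?_ _ ?_
  · intro I hI
    obtain ⟨h1, h2, -⟩ := hf I (hmem I hI)
    simp [h1, h2]
  · intro S _
    set C := G.unseen B S with hC
    set A' := A.filter fun v => (G.neighborFinset v ∩ C).card < t with hA'
    have hedges := card_mul_add_card_mul_le hAB hA hB (C := C) Finset.sdiff_subset t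
    rw [← hA'] at hedges
    have hfib : ∀ I ∈ {I ∈ {I : Set V | Maximal G.IsIndepSet I}.toFinset | f I = S},
        Maximal G.IsIndepSet I ∧ f I = S := fun I hI => by simpa using hI
    have hleA := card_le_two_pow_of_trace_subset (C := A') hAB hcover _
      (fun I hI => (hfib I hI).1) fun I hI v hv hvI => by
        obtain ⟨h, rfl⟩ := hfib I hI
        exact Finset.mem_filter.2 ⟨hv, (hf I h).2.2.2 v hv hvI⟩
    have hleB := card_le_two_pow_of_trace_subset (C := C) hAB.symm (fun v => (hcover v).symm) _
      (fun I hI => (hfib I hI).1) fun I hI v hv hvI => by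
        obtain ⟨h, rfl⟩ := hfib I hI
        exact (hf I h).2.2.1 v hv hvI
    have hrs : 0 < r + s := by omega
    rcases le_total A'.card C.card with h | h
    · refine hleA.trans (Nat.pow_le_pow_right two_pos ((Nat.le_div_iff_mul_le hrs).2 ?_))
      nlinarith
    · refine hleB.trans (Nat.pow_le_pow_right two_pos ((Nat.le_div_iff_mul_le hrs).2 ?_))
      nlinarith

/-- Subsets of density at most `1 / t` are few, by weighting each subset by `2⁻ʲ` per element. -/
theorem logb_card_filter_powerset_le {V : Type*} (A : Finset V) (b j : ℕ) {t : ℕ} (ht : 0 < t) :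
    Real.logb 2 (A.powerset.filter fun S => S.card * t ≤ b).card ≤
      j * (b / t : ℝ) + A.card * (2 * (2⁻¹ : ℝ) ^ j) := by
  set x : ℝ := (2⁻¹ : ℝ) ^ j with hx
  have hx0 : 0 < x := by positivity
  have hx1 : x ≤ 1 := pow_le_one₀ (by norm_num) (by norm_num)
  set P := A.powerset.filter fun S => S.card * t ≤ b with hP
  have hweight : (P.card : ℝ) * x ^ (b / t) ≤ (1 + x) ^ A.card := by
    calc (P.card : ℝ) * x ^ (b / t) = ∑ S ∈ P, x ^ (b / t) := by simp
      _ ≤ ∑ S ∈ P, x ^ S.card := Finset.sum_le_sum fun S hS =>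
          pow_le_pow_of_le_one hx0.le hx1
            ((Nat.le_div_iff_mul_le ht).2 (Finset.mem_filter.1 hS).2)
      _ ≤ ∑ S ∈ A.powerset, x ^ S.card :=
          Finset.sum_le_sum_of_subset_of_nonneg (Finset.filter_subset _ _)
            fun _ _ _ => by positivity
      _ = (1 + x) ^ A.card := by
          rw [add_comm, ← Finset.sum_pow_mul_eq_add_pow]
          simp
  have hPpos : (0 : ℝ) < P.card := by
    exact_mod_cast Finset.card_pos.2 ⟨∅, by simp [hP]⟩
  have hlog := Real.logb_le_logb_of_le one_lt_two (by positivity) hweight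
  rw [Real.logb_mul hPpos.ne' (by positivity), Real.logb_pow, Real.logb_pow, hx, Real.logb_pow,
    Real.logb_inv, Real.logb_self_eq_one one_lt_two, ← hx] at hlog
  have hlog1 : Real.logb 2 (1 + x) ≤ 2 * x := by
    rw [Real.logb, div_le_iff₀ (Real.log_pos one_lt_two)]
    have h1 := Real.log_le_sub_one_of_pos (show 0 < 1 + x by positivity)
    have h2 := Real.log_two_gt_d9
    nlinarith
  have hdiv : ((b / t : ℕ) : ℝ) ≤ b / t := Nat.cast_div_le
  have h3 := mul_le_mul_of_nonneg_left hlog1 (Nat.cast_nonneg A.card : (0 : ℝ) ≤ A.card)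
  have h4 := mul_le_mul_of_nonneg_left hdiv (Nat.cast_nonneg j : (0 : ℝ) ≤ j)
  linarith

theorem exists_logb_mis_le_of_le (ε : ℝ) (hε : 0 < ε) : ∃ D : ℕ,
    ∀ (V : Type) [Fintype V] [DecidableEq V] (G : SimpleGraph V) [DecidableRel G.Adj]
      (A B : Finset V) (r s : ℕ), G.IsBipartiteWith (A : Set V) B → (∀ v, v ∈ A ∨ v ∈ B) →
      (∀ v ∈ A, G.degree v = r) → (∀ v ∈ B, G.degree v = s) → s ≤ r → D ≤ r →
      Real.logb 2 (mis G) ≤ (1 + ε) * ((r : ℝ) * s * Fintype.card V) / ((r : ℝ) + s) ^ 2 := by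
  obtain ⟨j, hj⟩ := exists_pow_lt_of_lt_one (show 0 < ε / 12 by positivity)
    (show (2⁻¹ : ℝ) < 1 by norm_num)
  obtain ⟨t, ht⟩ := exists_nat_ge (6 * j / ε ^ 2 + 1)
  obtain ⟨D, hD⟩ := exists_nat_ge (3 * t / ε + 1)
  refine ⟨D, fun V _ _ G _ A B r s hAB hcover hA hB hsr hDr => ?_⟩
  have ht1 : (1 : ℝ) ≤ t := le_trans (le_add_of_nonneg_left (by positivity)) ht
  have hr3 : 3 * t / ε + 1 ≤ (r : ℝ) := hD.trans (by exact_mod_cast hDr)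
  have hr1 : (1 : ℝ) ≤ r := le_trans (le_add_of_nonneg_left (by positivity)) hr3
  have ht0 : 0 < t := by exact_mod_cast zero_lt_one.trans_le ht1
  have hr0 : 0 < r := by exact_mod_cast zero_lt_one.trans_le hr1
  have hmul : (A.card : ℝ) * r = B.card * s := by
    have h := SimpleGraph.isBipartiteWith_sum_degrees_eq hAB
    rw [Finset.sum_congr rfl hA, Finset.sum_congr rfl hB] at h
    simp only [Finset.sum_const, smul_eq_mul] at h
    exact_mod_cast h
  have hn : (Fintype.card V : ℝ) = A.card + B.card := by
    have hdisj : Disjoint A B := by exact_mod_cast hAB.disjoint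
    rw [← Nat.cast_add, ← Finset.card_union_of_disjoint hdisj, ← Finset.card_univ]
    congr 2
    ext v
    simpa using hcover v
  set a : ℝ := (A.card : ℝ) with ha
  have ha0 : 0 ≤ a := Nat.cast_nonneg _
  have hs0 : (0 : ℝ) ≤ s := Nat.cast_nonneg _
  have hrs : (0 : ℝ) < r + s := by positivity
  have htarget : (1 + ε) * ((r : ℝ) * s * Fintype.card V) / ((r : ℝ) + s) ^ 2 =
      (1 + ε) * (a * r / (r + s)) := by
    rw [hn, mul_div_assoc]
    congr 1
    rw [div_eq_div_iff (by positivity) (by positivity)]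
    linear_combination (-(r : ℝ) * (r + s)) * hmul
  rw [htarget]
  have hmis : (0 : ℝ) < mis G ∨ mis G = 0 := by
    rcases Nat.eq_zero_or_pos (mis G) with h | h
    · exact Or.inr h
    · exact Or.inl (by exact_mod_cast h)
  rcases hmis with hmis | hmis
  swap
  · rw [hmis]
    simp only [Nat.cast_zero, Real.logb_zero]
    positivity
  rcases le_or_gt (s : ℝ) (ε * r) with hs | hs
  · have h : Real.logb 2 (mis G) ≤ a := by
      have h2 : (mis G : ℝ) ≤ 2 ^ A.card := by exact_mod_cast mis_le_two_pow_card hAB hcover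
      have h3 := Real.logb_le_logb_of_le one_lt_two hmis h2
      rwa [Real.logb_pow, Real.logb_self_eq_one one_lt_two, mul_one] at h3
    refine h.trans ?_
    rw [← mul_div_assoc, le_div_iff₀ hrs]
    nlinarith
  · set P := (A.powerset.filter fun S => S.card * t ≤ B.card).card with hP
    have hPlog := logb_card_filter_powerset_le A B.card j ht0
    rw [← hP, ← ha] at hPlog
    have hPpos : (0 : ℝ) < P := by
      exact_mod_cast Finset.card_pos.2 ⟨∅, by simp⟩
    have hbound : (mis G : ℝ) ≤ 2 ^ (A.card * (r + t) / (r + s)) * P := by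
      exact_mod_cast mis_le_two_pow_mul_card hAB hcover hA hB hr0 ht0
    have hlog := Real.logb_le_logb_of_le one_lt_two hmis hbound
    rw [Real.logb_mul (by positivity) hPpos.ne', Real.logb_pow,
      Real.logb_self_eq_one one_lt_two, mul_one] at hlog
    have hdiv : ((A.card * (r + t) / (r + s) : ℕ) : ℝ) ≤ a * (r + t) / (r + s) := by
      refine Nat.cast_div_le.trans_eq ?_
      push_cast
      rfl
    have hb : (B.card : ℝ) * ε ≤ a := by
      have h : (B.card : ℝ) * ε * r ≤ a * r := by
        rw [hmul, mul_assoc]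
        exact mul_le_mul_of_nonneg_left hs.le (Nat.cast_nonneg _)
      exact le_of_mul_le_mul_right h (by positivity)
    have hfinger : j * (B.card / t : ℝ) ≤ a * (ε / 6) := by
      have h6 : 6 * (j : ℝ) ≤ t * ε ^ 2 := by
        rw [← div_le_iff₀ (by positivity)]
        linarith
      rw [← mul_div_assoc, div_le_iff₀ (by positivity)]
      have h7 := mul_le_mul_of_nonneg_left h6 (Nat.cast_nonneg B.card : (0 : ℝ) ≤ B.card)
      have h8 := mul_le_mul_of_nonneg_right hb (show 0 ≤ (t : ℝ) * ε by positivity)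
      nlinarith
    have hweight : a * (2 * (2⁻¹ : ℝ) ^ j) ≤ a * (ε / 6) :=
      mul_le_mul_of_nonneg_left (by linarith) ha0
    have hhalf : a / 2 ≤ a * r / (r + s) := by
      have hsr' : (s : ℝ) ≤ r := by exact_mod_cast hsr
      rw [div_le_div_iff₀ two_pos hrs]
      nlinarith
    have htr : (t : ℝ) ≤ ε / 3 * r := by
      have : 3 * (t : ℝ) / ε ≤ r := by linarith
      rw [div_le_iff₀ hε] at this
      linarith
    have hmain : a * (r + t) / (r + s) ≤ (1 + ε / 3) * (a * r / (r + s)) := by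
      rw [← mul_div_assoc]
      refine div_le_div_of_nonneg_right ?_ hrs.le
      nlinarith [mul_le_mul_of_nonneg_left htr ha0]
    have hscaled := mul_le_mul_of_nonneg_left hhalf hε.le
    linarith

theorem log_mis_le_of_biregular :
    ∀ ε : ℝ, 0 < ε → ∃ D : ℕ,
      ∀ (V : Type) [Fintype V] (G : SimpleGraph V) (A B : Set V) (r s : ℕ),
        (∀ v, v ∈ A ∨ v ∈ B) →
        (∀ v, ¬ (v ∈ A ∧ v ∈ B)) →
        (∀ u v, G.Adj u v → (u ∈ A ∧ v ∈ B) ∨ (u ∈ B ∧ v ∈ A)) →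
        (∀ v ∈ A, (G.neighborSet v).ncard = r) →
        (∀ v ∈ B, (G.neighborSet v).ncard = s) →
        D ≤ max r s →
        Real.logb 2 (mis G) ≤ (1 + ε) * ((r : ℝ) * s * Fintype.card V) / ((r : ℝ) + s) ^ 2 := by
  classical
  intro ε hε
  obtain ⟨D, hD⟩ := exists_logb_mis_le_of_le ε hε
  refine ⟨D, fun V _ G A B r s hcover hdisj hadj hA hB hmax => ?_⟩
  have hdeg : ∀ v, (G.neighborSet v).ncard = G.degree v := fun v => by
    rw [← G.card_neighborSet_eq_degree, Set.ncard_eq_toFinset_card', Set.toFinset_card]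
  simp only [hdeg] at hA hB
  have hAB : G.IsBipartiteWith (A.toFinset : Set V) B.toFinset := by
    rw [Set.coe_toFinset, Set.coe_toFinset]
    exact ⟨Set.disjoint_left.2 fun v hv hv' => hdisj v ⟨hv, hv'⟩, fun u v h => hadj u v h⟩
  rcases le_total s r with h | h
  · exact hD V G A.toFinset B.toFinset r s hAB (by simpa using hcover) (by simpa using hA)
      (by simpa using hB) h (by omega)
  · have := hD V G B.toFinset A.toFinset s r hAB.symm (by simpa [or_comm] using hcover)
      (by simpa using hB) (by simpa using hA) h (by omega)
    rwa [mul_comm (s : ℝ) r, add_comm (s : ℝ) r] at this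
end

section
/- If G is a bipartite graph with bipartition A ∪ B, then the number of maximal independent sets of G satisfies mis(G) ≤ 2^{min{|A|,|B|}}. -/
/-- A maximal independent set is determined by its trace on a vertex cover `S`. -/
theorem SimpleGraph.injOn_inter_of_vertexCover {V : Type*} (G : SimpleGraph V) (S : Set V)
    (hS : ∀ u v, G.Adj u v → u ∈ S ∨ v ∈ S) :
    Set.InjOn (fun I : Set V => I ∩ S)
      {I : Set V | Maximal (fun s : Set V => s.Pairwise fun a b => ¬ G.Adj a b) I} := by
  intro I hI J hJ hIJ
  rw [Set.mem_ofPred_eq] at hI hJ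
  have mem_iff {x : V} (hx : x ∈ S) : x ∈ I ↔ x ∈ J := by
    simpa [hx] using Set.ext_iff.mp hIJ x
  have not_adj {a b : V} (ha : a ∈ I) (hb : b ∈ J) : ¬ G.Adj a b := by
    intro hab
    rcases hS a b hab with h | h
    · exact hJ.prop ((mem_iff h).mp ha) hb hab.ne hab
    · exact hI.prop ha ((mem_iff h).mpr hb) hab.ne hab
  have hunion : (I ∪ J).Pairwise fun a b => ¬ G.Adj a b := by
    rintro a (ha | ha) b (hb | hb) hne
    · exact hI.prop ha hb hne
    · exact not_adj ha hb
    · exact fun hab => not_adj hb ha hab.symm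
    · exact hJ.prop ha hb hne
  exact (hI.eq_of_subset hunion Set.subset_union_left).trans
    (hJ.eq_of_subset hunion Set.subset_union_right).symm

theorem mis_le_two_pow_ncard_of_vertexCover {V : Type*} [Finite V] (G : SimpleGraph V)
    (S : Set V) (hS : ∀ u v, G.Adj u v → u ∈ S ∨ v ∈ S) : mis G ≤ 2 ^ S.ncard := by
  rw [← Set.ncard_powerset S]
  exact Set.ncard_le_ncard_of_injOn (fun I => I ∩ S) (fun _ _ => Set.inter_subset_right)
    (G.injOn_inter_of_vertexCover S hS)

theorem mis_le_two_pow_min_of_bipartite (V : Type*) [Fintype V] (G : SimpleGraph V)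
    (A B : Set V)
    (hcover : ∀ v, v ∈ A ∨ v ∈ B)
    (hdisj : ∀ v, ¬ (v ∈ A ∧ v ∈ B))
    (hbip : ∀ u v, G.Adj u v → (u ∈ A ∧ v ∈ B) ∨ (u ∈ B ∧ v ∈ A)) :
    mis G ≤ 2 ^ (min A.ncard B.ncard) := by
  rcases min_choice A.ncard B.ncard with h | h <;> rw [h] <;>
    refine mis_le_two_pow_ncard_of_vertexCover G _ fun u v huv => ?_ <;>
    have := hbip u v huv <;> tauto
end
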